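/- For any γ ∈ [3/4, 1) and any function f : [1,∞) → (0,∞) satisfying f(1) = 1 and the log-Lipschitz condition a^{3/4} f(n) ≤ f(an) ≤ a^γ f(n) for all real a, n ≥ 1, there exist a finitely generated group G with a finite symmetric generating set and a symmetric, finitely supported random walk X_n on G (whose step distribution has support generating G) such that E|X_n| ≍ H(X_n) ≍ f(n), with implied constants depending only on γ. -/

import Mathlib

open scoped BigOperators Classical

/-- Convolution of two measures (given as weight functions) on a group. -/
noncomputable def conv {G : Type*} [Group G] (μ ν : G → ℝ) : G → ℝ :=
  fun g => ∑' h, μ h * ν (h⁻¹ * g)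

/-- The `n`-fold convolution power of `μ`; `convPow μ n` is the distribution of `X_n`. -/
noncomputable def convPow {G : Type*} [Group G] (μ : G → ℝ) : ℕ → G → ℝ
  | 0 => fun g => if g = 1 then 1 else 0
  | n + 1 => conv (convPow μ n) μ

/-- Shannon entropy of a measure on a countable group:
`H(μ) = -∑ μ(g) log μ(g)` (with `0 log 0 = 0`). -/
noncomputable def entropy {G : Type*} (μ : G → ℝ) : ℝ :=
  ∑' g, Real.negMulLog (μ g)

/-- Word length with respect to a generating set `S`. -/
noncomputable def wordLength {G : Type*} [Group G] (S : Set G) (g : G) : ℕ :=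
  sInf {n | ∃ l : List G, l.length = n ∧ (∀ x ∈ l, x ∈ S) ∧ l.prod = g}

/-- Rate of escape: `E|X_n| = ∑ μ^{*n}(g) |g|`. -/
noncomputable def speed {G : Type*} [Group G] (S : Set G) (μ : G → ℝ) (n : ℕ) : ℝ :=
  ∑' g, convPow μ n g * (wordLength S g : ℝ)

/-- `μ` is a symmetric, finitely supported probability measure whose support generates `G`. -/
structure IsStepDist {G : Type*} [Group G] (μ : G → ℝ) : Prop where
  nonneg : ∀ g, 0 ≤ μ g
  total : ∑' g, μ g = 1
  symm : ∀ g, μ g⁻¹ = μ g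
  finSupp : (Function.support μ).Finite
  gen : Subgroup.closure (Function.support μ) = ⊤

/-- `S` is a finite symmetric generating set of `G`. -/
structure IsGenSet {G : Type*} [Group G] (S : Set G) : Prop where
  finite : S.Finite
  symm : ∀ s ∈ S, s⁻¹ ∈ S
  gen : Subgroup.closure S = ⊤

/-! ### Averages over a finite alphabet -/

/-- Uniform average. -/
noncomputable def favg {Ω : Type*} [Fintype Ω] (F : Ω → ℝ) : ℝ := (∑ x, F x) / (Fintype.card Ω : ℝ)

/-- Average over all words of length `n`. -/
noncomputable def Eavg {Ω : Type*} [Fintype Ω] : ℕ → (List Ω → ℝ) → ℝ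
  | 0, F => F []
  | n + 1, F => favg fun x => Eavg n fun l => F (x :: l)

section avg
variable {Ω : Type*} [Fintype Ω]

lemma favg_mono {F H : Ω → ℝ} (h : ∀ x, F x ≤ H x) : favg F ≤ favg H := by
  unfold favg; gcongr; exact h _

lemma favg_const [Nonempty Ω] (c : ℝ) : favg (fun _ : Ω => c) = c := by
  unfold favg; simp

lemma favg_add (F H : Ω → ℝ) : favg (fun x => F x + H x) = favg F + favg H := by
  unfold favg; rw [Finset.sum_add_distrib, add_div]

lemma favg_mul_left (c : ℝ) (F : Ω → ℝ) : favg (fun x => c * F x) = c * favg F := by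
  unfold favg; rw [← Finset.mul_sum, mul_div_assoc]

lemma favg_sum {ι : Type*} (s : Finset ι) (F : ι → Ω → ℝ) :
    favg (fun x => ∑ i ∈ s, F i x) = ∑ i ∈ s, favg (F i) := by
  unfold favg; rw [Finset.sum_comm, Finset.sum_div]

lemma favg_comm {Ω' : Type*} [Fintype Ω'] (F : Ω → Ω' → ℝ) :
    favg (fun x => favg (F x)) = favg (fun y => favg (fun x => F x y)) := by
  unfold favg
  simp only [← Finset.sum_div]
  rw [Finset.sum_comm, div_right_comm]

lemma favg_prod {Ω' : Type*} [Fintype Ω'] (F : Ω × Ω' → ℝ) :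
    favg F = favg (fun x => favg (fun y => F (x, y))) := by
  unfold favg
  simp only [← Finset.sum_div, Fintype.sum_prod_type, Fintype.card_prod]
  push_cast
  rw [div_div, mul_comm]

lemma favg_equiv {Ω' : Type*} [Fintype Ω'] (e : Ω ≃ Ω') (F : Ω' → ℝ) :
    favg (fun x => F (e x)) = favg F := by
  unfold favg
  rw [Equiv.sum_comp e F, Fintype.card_congr e]

lemma Eavg_congr (n : ℕ) : ∀ {F H : List Ω → ℝ}, (∀ l, l.length = n → F l = H l) →
    Eavg n F = Eavg n H := by
  induction n with
  | zero => intro F H h; exact h [] rfl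
  | succ n ih =>
    intro F H h
    simp only [Eavg]
    congr 1; funext x
    exact ih fun l hl => h _ (by simp [hl])

lemma Eavg_mono (n : ℕ) : ∀ {F H : List Ω → ℝ}, (∀ l, l.length = n → F l ≤ H l) →
    Eavg n F ≤ Eavg n H := by
  induction n with
  | zero => intro F H h; exact h [] rfl
  | succ n ih =>
    intro F H h
    exact favg_mono fun x => ih fun l hl => h _ (by simp [hl])

lemma Eavg_const [Nonempty Ω] (n : ℕ) (c : ℝ) : Eavg n (fun _ : List Ω => c) = c := by
  induction n with
  | zero => rfl
  | succ n ih => simp only [Eavg, ih, favg_const]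

lemma Eavg_zero (n : ℕ) : Eavg n (fun _ : List Ω => (0:ℝ)) = 0 := by
  induction n with
  | zero => rfl
  | succ n ih => simp only [Eavg, ih]; simp [favg]

lemma Eavg_nonneg (n : ℕ) {F : List Ω → ℝ} (h : ∀ l, l.length = n → 0 ≤ F l) : 0 ≤ Eavg n F :=
  (Eavg_zero (Ω := Ω) n).symm.le.trans (Eavg_mono n h)

lemma Eavg_add (n : ℕ) : ∀ (F H : List Ω → ℝ),
    Eavg n (fun x => F x + H x) = Eavg n F + Eavg n H := by
  induction n with
  | zero => intros; rfl
  | succ n ih => intro F H; simp only [Eavg, ih, favg_add]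

lemma Eavg_mul_left (n : ℕ) (c : ℝ) : ∀ (F : List Ω → ℝ),
    Eavg n (fun x => c * F x) = c * Eavg n F := by
  induction n with
  | zero => intros; rfl
  | succ n ih => intro F; simp only [Eavg, ih, favg_mul_left]

lemma Eavg_sum {ι : Type*} (s : Finset ι) (n : ℕ) : ∀ (F : ι → List Ω → ℝ),
    Eavg n (fun x => ∑ i ∈ s, F i x) = ∑ i ∈ s, Eavg n (F i) := by
  induction n with
  | zero => intros; rfl
  | succ n ih => intro F; simp only [Eavg, ih, favg_sum]

lemma Eavg_favg {Ω' : Type*} [Fintype Ω'] (n : ℕ) : ∀ (F : Ω' → List Ω → ℝ),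
    Eavg n (fun l => favg (fun y => F y l)) = favg (fun y => Eavg n (F y)) := by
  induction n with
  | zero => intros; rfl
  | succ n ih => intro F; simp only [Eavg, ih]; rw [favg_comm]

/-- splitting a product alphabet -/
lemma Eavg_prod {Ω' : Type*} [Fintype Ω'] (n : ℕ) : ∀ (F : List (Ω × Ω') → ℝ),
    Eavg n F = Eavg n (fun w => Eavg n (fun b => F (List.zip w b))) := by
  induction n with
  | zero => intros; rfl
  | succ n ih =>
    intro F
    simp only [Eavg, List.zip_cons_cons]
    rw [favg_prod]
    congr 1; funext x
    rw [Eavg_favg]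
    congr 1; funext y
    exact ih _

lemma Eavg_concave [Nonempty Ω] {φ : ℝ → ℝ} (hφ : ConcaveOn ℝ (Set.Ici 0) φ) (n : ℕ) :
    ∀ (F : List Ω → ℝ), (∀ l, 0 ≤ F l) → Eavg n (fun l => φ (F l)) ≤ φ (Eavg n F) := by
  induction n with
  | zero => intros; exact le_rfl
  | succ n ih =>
    intro F hF
    have hnn : ∀ x, 0 ≤ Eavg n fun l => F (x :: l) := fun x => by
      rw [← Eavg_zero (Ω := Ω) n]; exact Eavg_mono n fun l _ => hF _
    refine (favg_mono fun x => ih (fun l => F (x :: l)) fun l => hF _).trans ?_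
    have hc : (0:ℝ) < Fintype.card Ω := by exact_mod_cast Fintype.card_pos
    have := hφ.le_map_sum (t := Finset.univ) (w := fun _ : Ω => (Fintype.card Ω : ℝ)⁻¹)
      (p := fun x => Eavg n fun l => F (x :: l)) (fun _ _ => by positivity)
      (by simp [hc.ne']) (fun x _ => hnn x)
    simpa [Eavg, favg, ← Finset.mul_sum, div_eq_inv_mul] using this

lemma hasSum_Eavg {G : Type*} (n : ℕ) : ∀ (φ : List Ω → G) (R : List Ω → ℝ),
    HasSum (fun g => Eavg n (fun l => if φ l = g then R l else 0)) (Eavg n R) := by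
  induction n with
  | zero =>
    intro φ R
    simp only [Eavg]
    convert hasSum_ite_eq (φ []) (R []) using 2 with g
    by_cases h : φ [] = g
    · simp [h]
    · simp [h, Ne.symm h]
  | succ n ih =>
    intro φ R
    simp only [Eavg, favg]
    apply HasSum.div_const
    exact hasSum_sum fun x _ => ih (fun l => φ (x :: l)) (fun l => R (x :: l))

lemma finite_support_Eavg {G : Type*} (n : ℕ) (φ : List Ω → G) (R : List Ω → ℝ) :
    (Function.support (fun g => Eavg n (fun l => if φ l = g then R l else 0))).Finite := by
  refine ((List.finite_length_eq Ω n).image φ).subset ?_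
  intro g hg
  by_contra hcon
  apply hg
  change Eavg n _ = 0
  refine Eq.trans (Eavg_congr n fun l hl => ?_) (Eavg_zero (Ω := Ω) n)
  rw [if_neg]
  intro h
  exact hcon ⟨l, hl, h⟩

end avg

/-! ### Random walks driven by a uniform finite alphabet -/
section walk
variable {G : Type*} [Group G] {Ω : Type*} [Fintype Ω]

/-- product of a word; the head of the list is the rightmost factor -/
def wordOf (val : Ω → G) : List Ω → G
  | [] => 1
  | x :: l => wordOf val l * val x

/-- law of one step -/
noncomputable def stepLaw (val : Ω → G) : G → ℝ :=
  fun g => favg fun x => if val x = g then (1:ℝ) else 0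

lemma convPow_stepLaw (val : Ω → G) (n : ℕ) : ∀ g : G, convPow (stepLaw val) n g =
    Eavg n (fun l => if wordOf val l = g then (1:ℝ) else 0) := by
  induction n with
  | zero => intro g; simp [convPow, Eavg, wordOf, eq_comm]
  | succ n ih =>
    intro g
    simp only [convPow, conv, Eavg]
    have key : ∀ x : Ω, HasSum (fun h : G => convPow (stepLaw val) n h *
        (if val x = h⁻¹ * g then (1:ℝ) else 0)) (convPow (stepLaw val) n (g * (val x)⁻¹)) := by
      intro x
      convert hasSum_single (g * (val x)⁻¹) ?_ using 1
      · simp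
      · intro h hh
        rw [if_neg, mul_zero]
        intro h2; apply hh; rw [h2]; group
    have h2 := (hasSum_sum (s := Finset.univ) fun x _ => key x).div_const (Fintype.card Ω : ℝ)
    have h3 : (fun h : G => convPow (stepLaw val) n h * stepLaw val (h⁻¹ * g)) =
      fun b => (∑ i, convPow (stepLaw val) n b * if val i = b⁻¹ * g then (1:ℝ) else 0) /
        (Fintype.card Ω : ℝ) := by
      funext h; rw [← Finset.mul_sum]; simp only [stepLaw, favg]; ring
    rw [h3, h2.tsum_eq]
    unfold favg
    congr 1
    refine Finset.sum_congr rfl fun x _ => ?_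
    rw [ih]
    refine Eavg_congr n fun l _ => ?_
    have hw : wordOf val (x :: l) = wordOf val l * val x := rfl
    by_cases h : wordOf val (x :: l) = g
    · rw [if_pos h, if_pos (by rw [← h, hw]; group)]
    · rw [if_neg h, if_neg (fun h' => h (by rw [hw, h']; group))]

lemma speed_stepLaw (S : Set G) (val : Ω → G) (n : ℕ) : speed S (stepLaw val) n =
    Eavg n (fun l => (wordLength S (wordOf val l) : ℝ)) := by
  unfold speed
  rw [← (hasSum_Eavg n (wordOf val) (fun l => (wordLength S (wordOf val l) : ℝ))).tsum_eq]
  congr 1; funext g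
  rw [convPow_stepLaw, mul_comm, ← Eavg_mul_left]
  refine Eavg_congr n fun l _ => ?_
  by_cases h : wordOf val l = g
  · simp [h]
  · simp [h]

lemma isStepDist_stepLaw [Nonempty Ω] (val : Ω → G) (e : Ω ≃ Ω) (he : ∀ x, val (e x) = (val x)⁻¹)
    (hgen : Subgroup.closure (Set.range val) = ⊤) : IsStepDist (stepLaw val) := by
  have hsupp : Function.support (stepLaw val) = Set.range val := by
    ext g
    constructor
    · intro hg
      by_contra hcon
      apply hg
      have : ∀ x, val x ≠ g := fun x h => hcon ⟨x, h⟩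
      simp [stepLaw, favg, this]
    · rintro ⟨x, rfl⟩
      have hc : (0:ℝ) < Fintype.card Ω := by exact_mod_cast Fintype.card_pos
      have : (1:ℝ) ≤ ∑ y, if val y = val x then (1:ℝ) else 0 := by
        refine le_trans ?_ (Finset.single_le_sum (f := fun y => if val y = val x then (1:ℝ) else 0)
          (fun y _ => by positivity) (Finset.mem_univ x))
        simp
      have : 0 < stepLaw val (val x) := by unfold stepLaw favg; positivity
      exact this.ne'
  refine ⟨?_, ?_, ?_, ?_, ?_⟩
  · intro g; unfold stepLaw favg; positivity
  · have := (hasSum_Eavg 1 (wordOf val) (fun _ => (1:ℝ))).tsum_eq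
    rw [Eavg_const] at this
    simpa [Eavg, wordOf, stepLaw] using this
  · intro g
    unfold stepLaw
    rw [← favg_equiv e]
    congr 1; funext x
    rw [he]; simp only [inv_inj]
  · rw [hsupp]; exact Set.finite_range val
  · rw [hsupp]; exact hgen

end walk

/-! ### Entropy versus speed -/
section gibbs
variable {G : Type*} [Group G]

lemma exists_word {S : Set G} (hS : IsGenSet S) (g : G) :
    ∃ l : List G, l.length = wordLength S g ∧ (∀ x ∈ l, x ∈ S) ∧ l.prod = g := by
  have hne : {n | ∃ l : List G, l.length = n ∧ (∀ x ∈ l, x ∈ S) ∧ l.prod = g}.Nonempty := by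
    have hg : g ∈ (Subgroup.closure S).toSubmonoid := by rw [hS.gen]; trivial
    rw [Subgroup.closure_toSubmonoid] at hg
    obtain ⟨l, hl, hp⟩ := Submonoid.exists_list_of_mem_closure hg
    refine ⟨l.length, l, rfl, fun x hx => ?_, hp⟩
    rcases hl x hx with h | h
    · exact h
    · simpa using hS.symm _ h
  exact Nat.sInf_mem hne

lemma wordLength_le {S : Set G} {g : G} (l : List G) (hl : ∀ x ∈ l, x ∈ S) (hp : l.prod = g) :
    wordLength S g ≤ l.length := Nat.sInf_le ⟨l, rfl, hl, hp⟩

lemma card_sphere (σ : Fin 4 → G) (hS : IsGenSet (Set.range σ)) (F : Finset G) (k : ℕ) :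
    (F.filter (fun g => wordLength (Set.range σ) g = k)).card ≤ 4 ^ k := by
  have h : ∀ g : G, ∃ l : List (Fin 4), l.length = wordLength (Set.range σ) g ∧
      (l.map σ).prod = g := by
    intro g
    obtain ⟨l, h1, h2, h3⟩ := exists_word hS g
    have : ∃ l' : List (Fin 4), l'.map σ = l := by
      have := h2
      clear h1 h3
      induction l with
      | nil => exact ⟨[], rfl⟩
      | cons x l ih =>
        obtain ⟨l', rfl⟩ := ih (fun y hy => h2 y (by simp [hy])) (fun y hy => h2 y (by simp [hy]))
        obtain ⟨i, rfl⟩ := h2 x (by simp)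
        exact ⟨i :: l', rfl⟩
    obtain ⟨l', rfl⟩ := this
    exact ⟨l', by simpa using h1, h3⟩
  choose w hw1 hw2 using h
  have hc : Fintype.card (List.Vector (Fin 4) k) = 4 ^ k := by simp
  rw [← hc, ← Fintype.card_coe]
  refine Fintype.card_le_of_injective
    (fun g : (F.filter (fun g => wordLength (Set.range σ) g = k)) =>
      (⟨w g.1, by rw [hw1]; exact (Finset.mem_filter.1 g.2).2⟩ : List.Vector (Fin 4) k)) ?_
  intro g g' hgg
  have : w g.1 = w g'.1 := congrArg Subtype.val hgg
  apply Subtype.ext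
  rw [← hw2 g.1, this, hw2]

lemma sum_exp_wordLength (σ : Fin 4 → G) (hS : IsGenSet (Set.range σ)) (F : Finset G) (x : ℝ)
    (hx : 0 ≤ x) (hx4 : 4 * x < 1) :
    ∑ g ∈ F, x ^ (wordLength (Set.range σ) g) ≤ (1 - 4 * x)⁻¹ := by
  set K := F.sup (fun g => wordLength (Set.range σ) g) + 1
  have hmap : ∀ g ∈ F, wordLength (Set.range σ) g ∈ Finset.range K := fun g hg => by
    rw [Finset.mem_range]
    exact Nat.lt_succ_of_le (Finset.le_sup (f := fun g => wordLength (Set.range σ) g) hg)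
  rw [← Finset.sum_fiberwise_of_maps_to hmap]
  have : ∀ k ∈ Finset.range K, ∑ g ∈ F.filter (fun g => wordLength (Set.range σ) g = k),
      x ^ (wordLength (Set.range σ) g) ≤ (4 * x) ^ k := by
    intro k _
    rw [Finset.sum_congr rfl (g := fun _ => x ^ k)
      (fun g hg => by rw [(Finset.mem_filter.1 hg).2]), Finset.sum_const, nsmul_eq_mul, mul_pow]
    gcongr
    exact_mod_cast card_sphere σ hS F k
  refine (Finset.sum_le_sum this).trans ?_
  rw [← tsum_geometric_of_lt_one (by positivity) hx4]
  exact (summable_geometric_of_lt_one (by positivity) hx4).sum_le_tsum _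
    (fun _ _ => by positivity)

lemma entropy_le_speed {Ω : Type*} [Fintype Ω] [Nonempty Ω] (val : Ω → G)
    (σ : Fin 4 → G) (hS : IsGenSet (Set.range σ)) (n : ℕ) (κ : ℝ) (hκ : 4 * Real.exp (-κ) < 1) :
    entropy (convPow (stepLaw val) n) ≤
      κ * speed (Set.range σ) (stepLaw val) n + ((1 - 4 * Real.exp (-κ))⁻¹ - 1) := by
  set p := convPow (stepLaw val) n with hp
  have hpE : p = fun g => Eavg n (fun l => if wordOf val l = g then (1:ℝ) else 0) :=
    funext (convPow_stepLaw val n)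
  have hfin : (Function.support p).Finite := by
    rw [hpE]; exact finite_support_Eavg n (wordOf val) (fun _ => 1)
  set F := hfin.toFinset
  have hz : ∀ g ∉ F, p g = 0 := fun g hg => by simpa [F] using hg
  have htot : ∑ g ∈ F, p g = 1 := by
    have h := hasSum_Eavg n (wordOf val) (fun _ => (1:ℝ))
    rw [Eavg_const] at h
    rw [← h.tsum_eq, ← hpE, tsum_eq_sum hz]
  have hnn : ∀ g, 0 ≤ p g := fun g => by
    rw [hpE]
    exact Eavg_nonneg n fun l _ => by split_ifs <;> norm_num
  have e1 : entropy p = ∑ g ∈ F, Real.negMulLog (p g) :=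
    tsum_eq_sum fun g hg => by simp [hz g hg]
  have e2 : speed (Set.range σ) (stepLaw val) n = ∑ g ∈ F, p g * (wordLength (Set.range σ) g : ℝ) :=
    tsum_eq_sum fun g hg => by rw [← hp, hz g hg, zero_mul]
  have key : ∀ g ∈ F, Real.negMulLog (p g) ≤ κ * (p g * (wordLength (Set.range σ) g : ℝ)) +
      (Real.exp (-κ) ^ (wordLength (Set.range σ) g) - p g) := by
    intro g hg
    have hpos : 0 < p g := lt_of_le_of_ne (hnn g) (Ne.symm (by simpa [F] using hg))
    set q := Real.exp (-κ) ^ (wordLength (Set.range σ) g)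
    have hq : 0 < q := by positivity
    have h1 := Real.log_le_sub_one_of_pos (div_pos hq hpos)
    rw [Real.log_div hq.ne' hpos.ne'] at h1
    have hlq : Real.log q = - κ * (wordLength (Set.range σ) g : ℝ) := by
      simp only [q, Real.log_pow, Real.log_exp]; ring
    rw [hlq] at h1
    have h2 := mul_le_mul_of_nonneg_left h1 hpos.le
    have h3 : p g * (q / p g - 1) = q - p g := by field_simp
    rw [h3] at h2
    unfold Real.negMulLog
    nlinarith
  rw [e1, e2]
  refine (Finset.sum_le_sum key).trans ?_
  rw [Finset.sum_add_distrib, Finset.sum_sub_distrib, htot, ← Finset.mul_sum]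
  have := sum_exp_wordLength σ hS F (Real.exp (-κ)) (by positivity) hκ
  linarith

lemma entropy_ge {W B : Type*} [Fintype W] [Fintype B] [Nonempty W] [Nonempty B]
    (val : W × B → G) (n : ℕ) (R : List W → ℕ)
    (hR : ∀ w : List W, w.length = n → ∀ g : G,
      Eavg n (fun b : List B => if wordOf val (List.zip w b) = g then (1:ℝ) else 0)
        ≤ (1 / 2 : ℝ) ^ R w) :
    Real.log 2 * Eavg n (fun w => (R w : ℝ)) ≤ entropy (convPow (stepLaw val) n) := by
  set p := convPow (stepLaw val) n with hp
  have hpE : p = fun g => Eavg n (fun l => if wordOf val l = g then (1:ℝ) else 0) :=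
    funext (convPow_stepLaw val n)
  have hfin : (Function.support p).Finite := by
    rw [hpE]; exact finite_support_Eavg n (wordOf val) (fun _ => 1)
  set pw : List W → G → ℝ := fun w g =>
    Eavg n (fun b : List B => if wordOf val (List.zip w b) = g then (1:ℝ) else 0) with hpw
  have hpwnn : ∀ w g, 0 ≤ pw w g := fun w g => by
    rw [hpw]
    exact Eavg_nonneg n fun l _ => by split_ifs <;> norm_num
  have hpw2 : ∀ g, p g = Eavg n (fun w => pw w g) := fun g => by
    rw [hpE]; simp only []; rw [Eavg_prod]
  -- the lower bound series
  have hs : HasSum (fun g => Real.log 2 * Eavg n (fun w => (R w : ℝ) * pw w g))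
      (Real.log 2 * Eavg n (fun w => (R w : ℝ))) := by
    apply HasSum.mul_left
    have h := hasSum_Eavg n (wordOf val) (fun l : List (W × B) => (R (l.map Prod.fst) : ℝ))
    have e0 : ∀ w : List W, ∀ b : List B, w.length = n → b.length = n →
        (List.zip w b).map Prod.fst = w := fun w b h1 h2 =>
      List.map_fst_zip (by omega)
    have e1 : Eavg n (fun l : List (W × B) => (R (l.map Prod.fst) : ℝ)) =
        Eavg n (fun w => (R w : ℝ)) := by
      rw [Eavg_prod]
      refine Eavg_congr n fun w hw => ?_
      rw [Eavg_congr n (H := fun _ => (R w : ℝ)) fun b hb => by rw [e0 w b hw hb]]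
      exact Eavg_const n _
    rw [e1] at h
    have hfe : (fun g => Eavg n fun w => (R w:ℝ) * pw w g) = fun g =>
        Eavg n (fun l : List (W × B) =>
          if wordOf val l = g then (R (l.map Prod.fst) : ℝ) else 0) := by
      funext g
      symm
      rw [Eavg_prod]
      refine Eavg_congr n fun w hw => ?_
      rw [hpw]; simp only []
      rw [← Eavg_mul_left]
      refine Eavg_congr n fun b hb => ?_
      rw [e0 w b hw hb]
      split_ifs <;> simp
    rw [hfe]
    exact h
  have hs2 : Summable (fun g => Real.negMulLog (p g)) := by
    apply summable_of_hasFiniteSupport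
    refine hfin.subset fun g hg => ?_
    intro h
    apply hg
    simp [h]
  rw [← hs.tsum_eq]
  refine hs.summable.tsum_le_tsum (fun g => ?_) hs2
  rw [hpw2 g, ← Eavg_mul_left]
  refine le_trans (Eavg_mono n fun w hw => ?_)
    (Eavg_concave Real.concaveOn_negMulLog n (fun w => pw w g) (fun w => hpwnn w g))
  rcases (hpwnn w g).eq_or_lt with h0 | h0
  · rw [← h0]; simp
  · have h1 := Real.log_le_log h0 (hR w hw g)
    rw [Real.log_pow, one_div, Real.log_inv] at h1
    unfold Real.negMulLog
    nlinarith

end gibbs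

/-! ### The group -/

/-- Parameters of the construction. -/
structure Par where
  D : ℕ → ℕ
  q : ℕ → ℕ
  hD : ∀ s, 1 ≤ D s
  hq : ∀ s, 1 ≤ q s
  grow : ∀ s, 4 * (8 * D s * q s) ≤ 8 * D (s + 1) * q (s + 1)

namespace Par
variable (P : Par)

/-- side length of the `s`-th factor -/
def L (s : ℕ) : ℕ := 8 * P.D s * P.q s
/-- offset of the window -/
def h (s : ℕ) : ℕ := 4 * P.D s * P.q s

lemma L_pos (s : ℕ) : 0 < P.L s := by
  have := P.hD s; have := P.hq s; unfold L; positivity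

instance (s : ℕ) : NeZero (P.L s) := ⟨Nat.pos_iff_ne_zero.1 (P.L_pos s)⟩

/-- window patterns -/
abbrev Pat (s : ℕ) := Fin (P.D s) → ZMod 2
abbrev LampA := ∀ s, ZMod (P.L s) → ZMod 2
abbrev LampV := ∀ s, ZMod (P.L s) × P.Pat s → ZMod 2

/-- states -/
@[ext] structure St where
  c : ℤ
  A : P.LampA
  V : P.LampV

variable {P}

/-- window read at the row `x` -/
def win (s : ℕ) (A : P.LampA) (x : ZMod (P.L s)) : P.Pat s :=
  fun i => A s (x + (P.h s : ZMod (P.L s)) + ((i : ℕ) : ZMod (P.L s)))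

lemma win_add (s : ℕ) (A A' : P.LampA) (x : ZMod (P.L s)) :
    win s (A + A') x = win s A x + win s A' x := rfl

/-- elementary first level lamp change -/
noncomputable def dA (c : ℤ) : P.LampA := fun _ => Pi.single (c : ZMod _) 1
/-- elementary second level lamp change -/
noncomputable def dV (A : P.LampA) (c : ℤ) : P.LampV :=
  fun s => Pi.single ((c : ZMod _), win s A (c : ZMod _)) 1

lemma char2A (A B : P.LampA) : A + B + B = A := by
  funext s x
  simp only [Pi.add_apply, add_assoc, CharTwo.add_self_eq_zero, add_zero]
lemma char2V (A B : P.LampV) : A + B + B = A := by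
  funext s x
  simp only [Pi.add_apply, add_assoc, CharTwo.add_self_eq_zero, add_zero]

variable (P) in
noncomputable def pa (α : ZMod 2) : Equiv.Perm P.St where
  toFun x := ⟨x.c, x.A + α • dA x.c, x.V⟩
  invFun x := ⟨x.c, x.A + α • dA x.c, x.V⟩
  left_inv x := by simp only [char2A]
  right_inv x := by simp only [char2A]

variable (P) in
noncomputable def pb (β : ZMod 2) : Equiv.Perm P.St where
  toFun x := ⟨x.c, x.A, x.V + β • dV x.A x.c⟩
  invFun x := ⟨x.c, x.A, x.V + β • dV x.A x.c⟩
  left_inv x := by simp only [char2V]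
  right_inv x := by simp only [char2V]

variable (P) in
def pt (t : ℤ) : Equiv.Perm P.St where
  toFun x := ⟨x.c + t, x.A, x.V⟩
  invFun x := ⟨x.c - t, x.A, x.V⟩
  left_inv x := by simp
  right_inv x := by simp

lemma pa_inv (α : ZMod 2) : (pa P α)⁻¹ = pa P α := rfl
lemma pb_inv (α : ZMod 2) : (pb P α)⁻¹ = pb P α := rfl
lemma pt_inv (t : ℤ) : (pt P t)⁻¹ = pt P (-t) := by
  ext x <;> rfl
lemma pa_zero : pa P 0 = 1 := by
  ext1 x; simp [pa]
lemma pb_zero : pb P 0 = 1 := by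
  ext1 x; simp [pb]

variable (P) in
/-- the group -/
abbrev Gp : Subgroup (Equiv.Perm P.St) := Subgroup.closure {pa P 1, pb P 1, pt P 1}

lemma zmod2_cases (α : ZMod 2) : α = 0 ∨ α = 1 := by
  revert α; decide

lemma pa_mem (α : ZMod 2) : pa P α ∈ Gp P := by
  rcases zmod2_cases α with rfl | rfl
  · rw [pa_zero]; exact one_mem _
  · exact Subgroup.subset_closure (by simp)
lemma pb_mem (α : ZMod 2) : pb P α ∈ Gp P := by
  rcases zmod2_cases α with rfl | rfl
  · rw [pb_zero]; exact one_mem _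
  · exact Subgroup.subset_closure (by simp)
lemma pt_one_mem : pt P 1 ∈ Gp P := Subgroup.subset_closure (by simp)
lemma pt_neg_mem : pt P (-1) ∈ Gp P := by
  rw [← pt_inv]; exact inv_mem pt_one_mem

/-- sign of a coin -/
def sg (t : Bool) : ℤ := if t then 1 else -1
lemma pt_mem (t : Bool) : pt P (sg t) ∈ Gp P := by
  cases t
  · exact pt_neg_mem
  · exact pt_one_mem

variable (P) in
/-- the generators -/
noncomputable def gen : Fin 4 → Gp P :=
  ![⟨pa P 1, pa_mem 1⟩, ⟨pb P 1, pb_mem 1⟩, ⟨pt P 1, pt_one_mem⟩, ⟨pt P (-1), pt_neg_mem⟩]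

lemma closure_three : Subgroup.closure
    ({⟨pa P 1, pa_mem 1⟩, ⟨pb P 1, pb_mem 1⟩, ⟨pt P 1, pt_one_mem⟩} : Set (Gp P)) = ⊤ := by
  rw [eq_top_iff, ← Subgroup.closure_closure_coe_preimage]
  apply Subgroup.closure_mono
  rintro ⟨x, hx⟩ h
  simpa [Subtype.ext_iff] using h

lemma isGenSet_gen : IsGenSet (Set.range (gen P)) where
  finite := Set.finite_range _
  symm := by
    rintro _ ⟨i, rfl⟩
    fin_cases i
    · exact ⟨0, Subtype.ext rfl⟩
    · exact ⟨1, Subtype.ext rfl⟩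
    · exact ⟨3, Subtype.ext (pt_inv 1).symm⟩
    · refine ⟨2, Subtype.ext ?_⟩
      have := pt_inv (P := P) (-1)
      simpa [gen] using this.symm
  gen := by
    rw [eq_top_iff, ← closure_three]
    apply Subgroup.closure_mono
    rintro x (rfl | rfl | rfl)
    · exact ⟨0, rfl⟩
    · exact ⟨1, rfl⟩
    · exact ⟨2, rfl⟩

/-- Coins other than the first bit. -/
abbrev W := ZMod 2 × Bool × ZMod 2 × ZMod 2

variable (P) in
/-- permutation performed by one step -/
noncomputable def stp (x : W × ZMod 2) : Equiv.Perm P.St :=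
  pb P x.1.2.2.2 * pa P x.1.2.2.1 * pt P (sg x.1.2.1) * pa P x.1.1 * pb P x.2

variable (P) in
/-- one step -/
noncomputable def val (x : W × ZMod 2) : Gp P :=
  ⟨stp P x, mul_mem (mul_mem (mul_mem (mul_mem (pb_mem _) (pa_mem _)) (pt_mem _)) (pa_mem _))
    (pb_mem _)⟩

lemma sg_not (t : Bool) : sg (!t) = - sg t := by cases t <;> rfl

lemma isStepDist_val : IsStepDist (stepLaw (val P)) := by
  let r : W × ZMod 2 → W × ZMod 2 := fun x => ((x.1.2.2.1, !x.1.2.1, x.1.1, x.2), x.1.2.2.2)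
  have hr : Function.Involutive r := fun x => by
    rcases x with ⟨⟨a, t, b, c⟩, d⟩
    simp [r]
  refine isStepDist_stepLaw (val P) hr.toPerm (fun x => ?_) ?_
  · rcases x with ⟨⟨a, t, b, c⟩, d⟩
    apply Subtype.ext
    change stp P _ = (stp P _)⁻¹
    simp only [stp, mul_inv_rev, pa_inv, pb_inv, pt_inv, Function.Involutive.coe_toPerm, r,
      sg_not, mul_assoc]
  · rw [eq_top_iff, ← closure_three]
    have ht : (⟨pt P 1, pt_one_mem⟩ : Gp P) ∈ Subgroup.closure (Set.range (val P)) := by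
      refine Subgroup.subset_closure ⟨((0, true, 0, 0), 0), Subtype.ext ?_⟩
      simp [val, stp, pa_zero, pb_zero, sg]
    have hta : (⟨pt P 1, pt_one_mem⟩ * ⟨pa P 1, pa_mem 1⟩ : Gp P) ∈
        Subgroup.closure (Set.range (val P)) := by
      refine Subgroup.subset_closure ⟨((1, true, 0, 0), 0), Subtype.ext ?_⟩
      simp [val, stp, pa_zero, pb_zero, sg]
    have htb : (⟨pt P 1, pt_one_mem⟩ * ⟨pb P 1, pb_mem 1⟩ : Gp P) ∈
        Subgroup.closure (Set.range (val P)) := by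
      refine Subgroup.subset_closure ⟨((0, true, 0, 0), 1), Subtype.ext ?_⟩
      simp [val, stp, pa_zero, pb_zero, sg]
    rw [Subgroup.closure_le]
    rintro x (rfl | rfl | rfl)
    · exact (Subgroup.mul_mem_cancel_left _ ht).1 hta
    · exact (Subgroup.mul_mem_cancel_left _ ht).1 htb
    · exact ht

variable (P) in
/-- the base state -/
def x0 : P.St := ⟨0, 0, 0⟩

/-- symmetry of the state space commuting with the group -/
def hom (z : P.St) (x : P.St) : P.St where
  c := x.c + z.c
  A := fun s y => x.A s (y - (z.c : ZMod _)) + z.A s y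
  V := fun s y => x.V s (y.1 - (z.c : ZMod _), y.2 - win s z.A y.1) + z.V s y

lemma hom_x0 (z : P.St) : hom z (x0 P) = z := by
  ext <;> simp [hom, x0]

lemma hom_comm (z : P.St) (g : Equiv.Perm P.St) (hg : g ∈ Gp P) :
    ∀ x, g (hom z x) = hom z (g x) := by
  induction hg using Subgroup.closure_induction with
  | one => intro x; rfl
  | mul a b _ _ iha ihb => intro x; simp only [Equiv.Perm.mul_apply, ihb, iha]
  | inv a _ ih =>
    intro x
    rw [Equiv.Perm.inv_eq_iff_eq, ih]; simp
  | mem g hg =>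
    rcases hg with rfl | rfl | rfl
    · intro x
      apply St.ext
      · rfl
      · funext s y
        simp only [pa, hom, Equiv.coe_fn_mk, Pi.add_apply, Pi.smul_apply, dA, Pi.single_apply,
          one_smul, Int.cast_add, sub_eq_iff_eq_add]
        ring
      · rfl
    · intro x
      apply St.ext
      · rfl
      · rfl
      · funext s y
        have e : ∀ y : ZMod (P.L s) × P.Pat s,
            (y = (((x.c + z.c : ℤ) : ZMod (P.L s)), win s (hom z x).A ((x.c + z.c : ℤ) : ZMod _))) ↔
            ((y.1 - (z.c : ZMod _), y.2 - win s z.A y.1) = ((x.c : ZMod (P.L s)), win s x.A x.c)) := by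
          rintro ⟨y1, y2⟩
          simp only [Prod.mk.injEq, sub_eq_iff_eq_add, Int.cast_add]
          refine and_congr_right fun h1 => ?_
          subst h1
          have : win s (hom z x).A ((x.c : ZMod (P.L s)) + z.c) =
              win s x.A x.c + win s z.A ((x.c : ZMod (P.L s)) + z.c) := by
            funext i
            simp only [win, hom, Pi.add_apply]
            congr 2
            ring
          rw [this]
        simp only [pb, hom, Equiv.coe_fn_mk, Pi.add_apply, Pi.smul_apply, dV, Pi.single_apply,
          one_smul]
        have e' := e y
        simp only [hom] at e'
        simp only [e']
        ring
    · intro x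
      apply St.ext
      · simp only [pt, hom, Equiv.coe_fn_mk]; ring
      · rfl
      · rfl

lemma free_x0 {g g' : Equiv.Perm P.St} (hg : g ∈ Gp P) (hg' : g' ∈ Gp P)
    (h : g (x0 P) = g' (x0 P)) : g = g' := by
  ext1 z
  rw [← hom_x0 z, hom_comm z g hg, hom_comm z g' hg', h]

end Par

namespace Par
variable {P : Par}

/-! ### Reachability -/

/-- `y` can be reached from `x` by at most `n` generators -/
def Reach (n : ℕ) (x y : P.St) : Prop :=
  ∃ l : List (Gp P), l.length ≤ n ∧ (∀ g ∈ l, g ∈ Set.range (gen P)) ∧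
    (l.prod : Equiv.Perm P.St) x = y

lemma Reach.refl (x : P.St) : Reach 0 x x := ⟨[], by simp, by simp, rfl⟩

lemma Reach.trans {m n : ℕ} {x y z : P.St} (h : Reach m x y) (h' : Reach n y z) :
    Reach (m + n) x z := by
  obtain ⟨l, a, b, c⟩ := h
  obtain ⟨l', a', b', c'⟩ := h'
  refine ⟨l' ++ l, by simp; omega, ?_, ?_⟩
  · intro g hg
    rcases List.mem_append.1 hg with h | h
    · exact b' _ h
    · exact b _ h
  · rw [List.prod_append, Subgroup.coe_mul, Equiv.Perm.mul_apply, c, c']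

lemma Reach.mono {m n : ℕ} {x y : P.St} (h : Reach m x y) (hmn : m ≤ n) : Reach n x y := by
  obtain ⟨l, a, b, c⟩ := h
  exact ⟨l, a.trans hmn, b, c⟩

lemma reach_gen (i : Fin 4) (x : P.St) : Reach 1 x ((gen P i : Equiv.Perm P.St) x) :=
  ⟨[gen P i], by simp, by simp, by simp⟩

lemma reach_pa (α : ZMod 2) (x : P.St) : Reach 1 x (pa P α x) := by
  rcases zmod2_cases α with rfl | rfl
  · rw [pa_zero]; exact (Reach.refl x).mono (by omega)
  · exact reach_gen 0 x
lemma reach_pb (α : ZMod 2) (x : P.St) : Reach 1 x (pb P α x) := by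
  rcases zmod2_cases α with rfl | rfl
  · rw [pb_zero]; exact (Reach.refl x).mono (by omega)
  · exact reach_gen 1 x

lemma reach_right (n : ℕ) (c : ℤ) (A : P.LampA) (V : P.LampV) :
    Reach n ⟨c, A, V⟩ ⟨c + n, A, V⟩ := by
  induction n with
  | zero => simpa using Reach.refl (P := P) ⟨c, A, V⟩
  | succ n ih =>
    refine ih.trans ?_
    have := reach_gen 2 (P := P) ⟨c + n, A, V⟩
    convert this using 1
    simp [gen, pt, add_assoc]

lemma reach_left (n : ℕ) (c : ℤ) (A : P.LampA) (V : P.LampV) :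
    Reach n ⟨c, A, V⟩ ⟨c - n, A, V⟩ := by
  induction n with
  | zero => simpa using Reach.refl (P := P) ⟨c, A, V⟩
  | succ n ih =>
    refine ih.trans ?_
    have := reach_gen 3 (P := P) ⟨c - n, A, V⟩
    convert this using 1
    simp [gen, pt]
    ring

lemma reach_move (c c' : ℤ) (n : ℕ) (h : |c' - c| ≤ n) (A : P.LampA) (V : P.LampV) :
    Reach n ⟨c, A, V⟩ ⟨c', A, V⟩ := by
  rw [abs_le] at h
  rcases le_total c c' with hc | hc
  · have := reach_right (c' - c).toNat c A V
    rw [show c + ((c' - c).toNat : ℤ) = c' by omega] at this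
    exact this.mono (by omega)
  · have := reach_left (c - c').toNat c A V
    rw [show c - ((c - c').toNat : ℤ) = c' by omega] at this
    exact this.mono (by omega)

lemma sum_Ico_succ_int {M : Type*} [AddCommMonoid M] (p : ℤ) (n : ℕ) (F : ℤ → M) :
    ∑ i ∈ Finset.Ico p (p + (n + 1 : ℕ)), F i = ∑ i ∈ Finset.Ico p (p + n), F i + F (p + n) := by
  have : Finset.Ico p (p + (n + 1 : ℕ)) = insert (p + (n:ℤ)) (Finset.Ico p (p + n)) := by
    ext x; simp only [Finset.mem_Ico, Finset.mem_insert]; push_cast; omega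
  rw [this, Finset.sum_insert (by simp), add_comm]

/-- total first level change of a sweep -/
noncomputable def swA (α : ℤ → ZMod 2) (p : ℤ) (n : ℕ) : P.LampA :=
  ∑ i ∈ Finset.Ico p (p + n), α i • dA i
/-- total second level change of a sweep -/
noncomputable def swV (A : P.LampA) (β : ℤ → ZMod 2) (p : ℤ) (n : ℕ) : P.LampV :=
  ∑ i ∈ Finset.Ico p (p + n), β i • dV A i

lemma reach_swA (α : ℤ → ZMod 2) (p : ℤ) (n : ℕ) (A : P.LampA) (V : P.LampV) :
    Reach (2 * n) ⟨p, A, V⟩ ⟨p + n, A + swA α p n, V⟩ := by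
  induction n with
  | zero => simpa [swA] using Reach.refl (P := P) ⟨p, A, V⟩
  | succ n ih =>
    have h1 := reach_pa (α (p + n)) (⟨p + n, A + swA α p n, V⟩ : P.St)
    have h2 := h1.trans (reach_gen 2 _)
    have h3 := ih.trans h2
    rw [show 2 * (n + 1) = 2 * n + (1 + 1) by ring]
    convert h3 using 1
    refine St.ext ?_ ?_ rfl
    · change p + ((n + 1 : ℕ) : ℤ) = p + n + 1
      push_cast; ring
    · change A + swA α p (n + 1) = A + swA α p n + α (p + n) • dA (p + n)
      simp only [swA, sum_Ico_succ_int, add_assoc]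

lemma reach_swV (β : ℤ → ZMod 2) (p : ℤ) (n : ℕ) (A : P.LampA) (V : P.LampV) :
    Reach (2 * n) ⟨p, A, V⟩ ⟨p + n, A, V + swV A β p n⟩ := by
  induction n with
  | zero => simpa [swV] using Reach.refl (P := P) ⟨p, A, V⟩
  | succ n ih =>
    have h1 := reach_pb (β (p + n)) (⟨p + n, A, V + swV A β p n⟩ : P.St)
    have h2 := h1.trans (reach_gen 2 _)
    have h3 := ih.trans h2
    rw [show 2 * (n + 1) = 2 * n + (1 + 1) by ring]
    convert h3 using 1
    refine St.ext ?_ rfl ?_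
    · change p + ((n + 1 : ℕ) : ℤ) = p + n + 1
      push_cast; ring
    · change V + swV A β p (n + 1) = V + swV A β p n + β (p + n) • dV A (p + n)
      simp only [swV, sum_Ico_succ_int, add_assoc]

/-- state obtained by an excursion in an interval -/
noncomputable def exc (z : P.St) (α β : ℤ → ZMod 2) (p : ℤ) (n : ℕ) (c' : ℤ) : P.St :=
  ⟨c', z.A + swA α p n, z.V + swV z.A β p n⟩

lemma reach_exc (z : P.St) (α β : ℤ → ZMod 2) (p : ℤ) (n : ℕ) (c' : ℤ)
    (h1 : z.c ∈ Set.Ico p (p + n)) (h2 : c' ∈ Set.Ico p (p + n)) :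
    Reach (7 * n) z (exc z α β p n c') := by
  obtain ⟨c, A, V⟩ := z
  simp only [Set.mem_Ico] at h1 h2
  have a1 := reach_move c p n (by rw [abs_le]; omega) A V
  have a2 := reach_swV β p n A V
  have a3 := reach_move (p + n) p n (by rw [abs_le]; omega) A (V + swV A β p n)
  have a4 := reach_swA α p n A (V + swV A β p n)
  have a5 := reach_move (p + n) c' n (by rw [abs_le]; omega) (A + swA α p n) (V + swV A β p n)
  exact ((((a1.trans a2).trans a3).trans a4).trans a5).mono (by omega)

/-- a conjugated second level sweep -/
lemma reach_conj (α β : ℤ → ZMod 2) (p : ℤ) (n : ℕ) (A : P.LampA) (V : P.LampV) :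
    Reach (9 * n) ⟨p, A, V⟩ ⟨p, A, V + swV (A + swA α p n) β p n⟩ := by
  set B : P.LampA := swA α p n
  have a1 := reach_swA α p n A V
  have a2 := reach_move (p + n) p n (by rw [abs_le]; omega) (A + B) V
  have a3 := reach_swV β p n (A + B) V
  have a4 := reach_move (p + n) p n (by rw [abs_le]; omega) (A + B) (V + swV (A + B) β p n)
  have a5 := reach_swA α p n (A + B) (V + swV (A + B) β p n)
  rw [show A + B + swA α p n = A from char2A A B] at a5
  have a6 := reach_move (p + n) p n (by rw [abs_le]; omega) A (V + swV (A + B) β p n)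
  exact (((((a1.trans a2).trans a3).trans a4).trans a5).trans a6).mono (by omega)

lemma reach_conj_sum {ι : Type*} (J : Finset ι) (α β : ι → ℤ → ZMod 2) (p : ℤ) (n : ℕ)
    (A : P.LampA) (V : P.LampV) :
    Reach (J.card * (9 * n)) ⟨p, A, V⟩
      ⟨p, A, V + ∑ j ∈ J, swV (A + swA (α j) p n) (β j) p n⟩ := by
  induction J using Finset.induction_on with
  | empty => simpa using Reach.refl (P := P) ⟨p, A, V⟩
  | insert j J hj ih =>
    rw [Finset.card_insert_of_notMem hj, Finset.sum_insert hj, add_mul, one_mul,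
      add_comm (swV _ _ _ _), ← add_assoc V]
    exact ih.trans (reach_conj _ _ _ _ _ _)

/-! ### Windows far away -/

lemma h_eq (s : ℕ) : P.L s = 2 * P.h s := by unfold L h; ring
lemma D_le (s : ℕ) : 8 * P.D s ≤ P.L s := by
  have := P.hq s
  unfold L
  nlinarith [P.hD s]

lemma L_grow {s s' : ℕ} (h : s < s') : 4 * P.L s ≤ P.L s' := by
  induction s' with
  | zero => omega
  | succ n ih =>
    have := P.grow n
    change 4 * P.L n ≤ P.L (n + 1) at this
    rcases Nat.lt_succ_iff_lt_or_eq.1 h with h | rfl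
    · have := ih h; omega
    · exact this

lemma L_mono {s s' : ℕ} (h : s ≤ s') : P.L s ≤ P.L s' := by
  rcases h.eq_or_lt with rfl | h
  · rfl
  · have := L_grow (P := P) h; omega

lemma win_far (s : ℕ) (c i : ℤ) (j : Fin (P.D s)) (hci : 4 * |c - i| ≤ P.L s) :
    (c : ZMod (P.L s)) + (P.h s : ZMod (P.L s)) + ((j : ℕ) : ZMod (P.L s)) ≠ (i : ZMod _) := by
  intro h
  have h' : ((c + P.h s + (j : ℕ) : ℤ) : ZMod (P.L s)) = (i : ZMod _) := by
    push_cast; exact h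
  rw [ZMod.intCast_eq_intCast_iff_dvd_sub] at h'
  have h1 := h_eq (P := P) s
  have h2 := D_le (P := P) s
  have h3 := j.2
  have h4 := P.hD s
  have h5 : 4 * (c - i) ≤ P.L s := le_trans (by gcongr; exact le_abs_self _) hci
  have h6 : - (4 * (c - i)) ≤ P.L s :=
    le_trans (by rw [← mul_neg]; gcongr; exact neg_le_abs _) hci
  obtain ⟨k, hk⟩ := h'
  have hk0 : k < 0 := by
    by_contra hcon
    have : 0 ≤ (P.L s : ℤ) * k := mul_nonneg (by positivity) (not_lt.1 hcon)
    omega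
  have hk1 : -1 < k := by
    by_contra hcon
    have : (P.L s : ℤ) * k ≤ (P.L s : ℤ) * (-1) := by gcongr; omega
    omega
  omega

lemma win_swA_far (s : ℕ) (A : P.LampA) (α : ℤ → ZMod 2) (p : ℤ) (n : ℕ) (c : ℤ)
    (hc : c ∈ Set.Ico p (p + n)) (hn : 4 * (n : ℤ) ≤ P.L s + 4) :
    win s (A + swA α p n) (c : ZMod _) = win s A (c : ZMod _) := by
  funext j
  simp only [win, Pi.add_apply, swA, Finset.sum_apply, Pi.smul_apply]
  rw [Finset.sum_eq_zero, add_zero]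
  intro i hi
  rw [dA, Pi.single_apply, if_neg, smul_zero]
  refine win_far s c i j ?_
  simp only [Set.mem_Ico, Finset.mem_Ico] at hc hi
  have : |c - i| ≤ n - 1 := by rw [abs_le]; omega
  omega

/-! ### Row sums and similarity -/

/-- row sums -/
noncomputable def row (V : P.LampV) (s : ℕ) (x : ZMod (P.L s)) : ZMod 2 := ∑ η, V s (x, η)

lemma row_add (V V' : P.LampV) (s : ℕ) (x : ZMod (P.L s)) :
    row (V + V') s x = row V s x + row V' s x := by
  simp [row, Finset.sum_add_distrib]
lemma row_smul (β : ZMod 2) (V : P.LampV) (s : ℕ) (x : ZMod (P.L s)) :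
    row (β • V) s x = β * row V s x := by
  simp [row, Finset.mul_sum]
lemma row_sum {ι : Type*} (J : Finset ι) (V : ι → P.LampV) (s : ℕ) (x : ZMod (P.L s)) :
    row (∑ j ∈ J, V j) s x = ∑ j ∈ J, row (V j) s x := by
  simp only [row, Finset.sum_apply]; rw [Finset.sum_comm]
lemma row_dV (A : P.LampA) (c : ℤ) (s : ℕ) (x : ZMod (P.L s)) :
    row (dV A c) s x = if x = (c : ZMod _) then 1 else 0 := by
  simp only [row, dV, Pi.single_apply, Prod.mk.injEq]
  by_cases h : x = (c : ZMod _)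
  · simp [h]
  · simp [h]

/-- similar states -/
structure Sim (s0 : ℕ) (y z : P.St) : Prop where
  c : y.c = z.c
  A : y.A = z.A
  V : ∀ s, s0 ≤ s → y.V s = z.V s
  row : ∀ s x, row y.V s x = row z.V s x

lemma Sim.eq {y z : P.St} (h : Sim 0 y z) : y = z :=
  St.ext h.c h.A (funext fun s => h.V s (Nat.zero_le _))

end Par

namespace Par
variable {P : Par}

/-! ### The correction step -/

instance (s : ℕ) : NeZero (P.D s) := ⟨by have := P.hD s; omega⟩

lemma sum_res {M : Type*} [AddCommMonoid M] (L : ℕ) [NeZero L] (p : ℤ) (F : ZMod L → M) :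
    ∑ y ∈ Finset.Ico p (p + L), F (y : ZMod L) = ∑ x, F x := by
  have hL : (0 : ℤ) < L := by have := NeZero.pos L; exact_mod_cast this
  refine Finset.sum_bij (fun y _ => (y : ZMod L)) (fun _ _ => Finset.mem_univ _) ?_ ?_
    (fun _ _ => rfl)
  · intro a ha b hb hab
    rw [Finset.mem_Ico] at ha hb
    rw [ZMod.intCast_eq_intCast_iff_dvd_sub] at hab
    have : b - a = 0 := Int.eq_zero_of_abs_lt_dvd hab (by rw [abs_lt]; omega)
    omega
  · intro x _
    obtain ⟨X, rfl⟩ := ZMod.intCast_surjective x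
    refine ⟨p + (X - p) % L, ?_, ?_⟩
    · have h1 := Int.emod_nonneg (X - p) hL.ne'
      have h2 := Int.emod_lt_of_pos (X - p) hL
      rw [Finset.mem_Ico]; omega
    · rw [ZMod.intCast_eq_intCast_iff_dvd_sub]
      have := Int.emod_add_mul_ediv (X - p) L
      exact ⟨(X - p) / L, by linarith⟩

/-- rotated pattern -/
def rot (s : ℕ) (i : ℤ) (j : ZMod (P.D s) → ZMod 2) : P.Pat s :=
  fun k => j ((i : ZMod (P.D s)) + ((k : ℕ) : ZMod (P.D s)))

lemma rot_sum {M : Type*} [AddCommMonoid M] (s : ℕ) (i : ℤ) (w : P.Pat s) (F : P.Pat s → M) :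
    ∑ j : ZMod (P.D s) → ZMod 2, F (w + rot s i j) = ∑ η, F η := by
  have hinj : Function.Injective
      (fun k : Fin (P.D s) => (i : ZMod (P.D s)) + ((k : ℕ) : ZMod (P.D s))) := by
    intro k k' hk
    have h1 : ((k : ℕ) : ZMod (P.D s)) = ((k' : ℕ) : ZMod (P.D s)) := add_left_cancel hk
    rw [ZMod.natCast_eq_natCast_iff'] at h1
    rw [Nat.mod_eq_of_lt k.2, Nat.mod_eq_of_lt k'.2] at h1
    exact Fin.ext h1
  have hbij : Function.Bijective
      (fun k : Fin (P.D s) => (i : ZMod (P.D s)) + ((k : ℕ) : ZMod (P.D s))) :=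
    (Fintype.bijective_iff_injective_and_card _).2 ⟨hinj, by simp⟩
  let e := Equiv.ofBijective _ hbij
  let E : (ZMod (P.D s) → ZMod 2) ≃ P.Pat s :=
    (Equiv.arrowCongr e.symm (Equiv.refl _)).trans (Equiv.addLeft w)
  exact Equiv.sum_comp E F

lemma swA_full (s : ℕ) (j : ZMod (P.D s) → ZMod 2) (p : ℤ) (x : ZMod (P.L s)) :
    (swA (fun i => j (i : ZMod (P.D s))) p (P.L s) : P.LampA) s x =
      j (ZMod.castHom (show P.D s ∣ P.L s from ⟨8 * P.q s, by unfold L; ring⟩) _ x) := by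
  have hd : P.D s ∣ P.L s := ⟨8 * P.q s, by unfold L; ring⟩
  simp only [swA, Finset.sum_apply, Pi.smul_apply, dA]
  have := sum_res (P.L s) p (fun y => j (ZMod.castHom hd (ZMod (P.D s)) y) •
    (Pi.single y 1 : ZMod (P.L s) → ZMod 2) x)
  simp only [map_intCast] at this
  rw [this, Finset.sum_eq_single x]
  · simp
  · intro b _ hb
    rw [Pi.single_apply, if_neg (Ne.symm hb), smul_zero]
  · intro h; exact absurd (Finset.mem_univ _) h

lemma win_swA_full (s : ℕ) (A : P.LampA) (j : ZMod (P.D s) → ZMod 2) (p i : ℤ) :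
    win s (A + swA (fun i => j (i : ZMod (P.D s))) p (P.L s)) (i : ZMod _) =
      win s A (i : ZMod _) + rot s i j := by
  rw [win_add]
  congr 1
  funext k
  simp only [win, swA_full, map_add, map_intCast, map_natCast, rot]
  have : ((P.h s : ℕ) : ZMod (P.D s)) = 0 := by
    rw [ZMod.natCast_eq_zero_iff]
    exact ⟨4 * P.q s, by unfold h; ring⟩
  rw [this, add_zero]

lemma correct (s : ℕ) (y z : P.St) (h : Sim (s + 1) y z) :
    ∃ z', Reach (2 ^ P.D s * (9 * P.L s)) z z' ∧ Sim s y z' := by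
  set u : ZMod (P.L s) × P.Pat s → ZMod 2 := y.V s + z.V s with hu
  have hu0 : ∀ x, ∑ η, u (x, η) = 0 := fun x => by
    have := h.row s x
    simp only [hu, Pi.add_apply, Finset.sum_add_distrib]
    unfold Par.row at this
    rw [this, CharTwo.add_self_eq_zero]
  set α : (ZMod (P.D s) → ZMod 2) → ℤ → ZMod 2 := fun j i => j (i : ZMod (P.D s)) with hα
  set β : (ZMod (P.D s) → ZMod 2) → ℤ → ZMod 2 := fun j i =>
    u ((i : ZMod _), win s z.A (i : ZMod _) + rot s i j) with hβ
  have hβ0 : ∀ i, ∑ j, β j i = 0 := fun i => by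
    rw [hβ]; simp only []
    rw [rot_sum s i (win s z.A (i : ZMod _)) (fun η => u ((i : ZMod _), η)), hu0]
  have hr := reach_conj_sum (P := P) Finset.univ α β z.c (P.L s) z.A z.V
  rw [Finset.card_univ, Fintype.card_fun, ZMod.card, ZMod.card] at hr
  refine ⟨_, hr, h.c, h.A, ?_, ?_⟩
  · intro s' hs'
    rcases hs'.eq_or_lt with rfl | hlt
    · simp only [Pi.add_apply, Finset.sum_apply, swV, Pi.smul_apply, dV, hα]
      rw [Finset.sum_comm]
      have e1 : ∀ i : ℤ, (∑ j, β j i • (Pi.single ((i : ZMod (P.L s)),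
          win s (z.A + swA (fun i => j (i : ZMod (P.D s))) z.c (P.L s)) (i : ZMod _)) 1 :
            ZMod (P.L s) × P.Pat s → ZMod 2)) =
          ∑ η, u ((i : ZMod _), η) • (Pi.single ((i : ZMod (P.L s)), η) 1 :
            ZMod (P.L s) × P.Pat s → ZMod 2) := by
        intro i
        rw [← rot_sum s i (win s z.A (i : ZMod _))]
        refine Finset.sum_congr rfl fun j _ => ?_
        rw [win_swA_full]
      rw [Finset.sum_congr rfl fun i _ => e1 i]
      rw [sum_res (P.L s) z.c (fun x => ∑ η, u (x, η) • (Pi.single (x, η) 1 :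
            ZMod (P.L s) × P.Pat s → ZMod 2))]
      have e2 : (∑ x, ∑ η, u (x, η) • (Pi.single (x, η) 1 :
            ZMod (P.L s) × P.Pat s → ZMod 2)) = u := by
        rw [← Fintype.sum_prod_type (f := fun w => u w • (Pi.single w 1 :
            ZMod (P.L s) × P.Pat s → ZMod 2))]
        funext w
        simp [Finset.sum_apply, Pi.single_apply]
      rw [e2, hu]
      funext w
      simp only [Pi.add_apply]
      rw [add_comm (y.V s w), ← add_assoc, CharTwo.add_self_eq_zero, zero_add]
    · rw [h.V s' hlt]
      simp only [Pi.add_apply, Finset.sum_apply, swV, Pi.smul_apply]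
      rw [Finset.sum_comm, Finset.sum_eq_zero, add_zero]
      intro i hi
      have : ∀ j, dV (z.A + swA (α j) z.c (P.L s)) i s' = dV z.A i s' := by
        intro j
        unfold dV
        rw [win_swA_far]
        · simpa using hi
        · have := L_grow (P := P) hlt
          omega
      simp only [this]
      rw [← Finset.sum_smul, hβ0, zero_smul]
  · intro s' x
    rw [h.row s' x]
    simp only [row_add, row_sum, swV, row_smul, row_dV]
    rw [Finset.sum_comm, Finset.sum_eq_zero, add_zero]
    intro i _
    rw [← Finset.sum_mul, hβ0, zero_mul]

/-- total cost of the corrections -/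
def corr (P : Par) (s0 : ℕ) : ℕ := ∑ s ∈ Finset.range s0, 2 ^ P.D s * (9 * P.L s)

lemma reach_of_sim (s0 : ℕ) : ∀ (y z : P.St), Sim s0 y z → Reach (corr P s0) z y := by
  induction s0 with
  | zero => intro y z h; rw [h.eq]; exact Reach.refl _
  | succ s ih =>
    intro y z h
    obtain ⟨z', h1, h2⟩ := correct s y z h
    exact (h1.trans (ih y z' h2)).mono (by unfold corr; rw [Finset.sum_range_succ]; omega)

/-! ### Excursions -/

lemma swA_single (α : ℤ → ZMod 2) (p : ℤ) (n : ℕ) (c : ℤ) (a : ZMod 2)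
    (hc : c ∈ Set.Ico p (p + n)) :
    (swA (α + Pi.single c a) p n : P.LampA) = swA α p n + a • dA c := by
  simp only [swA, Pi.add_apply, add_smul, Finset.sum_add_distrib]
  congr 1
  rw [Finset.sum_eq_single c]
  · simp
  · intro b _ hb; simp [hb]
  · intro h; simp at h hc; omega

lemma swV_single (A : P.LampA) (α : ℤ → ZMod 2) (p : ℤ) (n : ℕ) (c : ℤ) (a : ZMod 2)
    (hc : c ∈ Set.Ico p (p + n)) :
    (swV A (α + Pi.single c a) p n : P.LampV) = swV A α p n + a • dV A c := by
  simp only [swV, Pi.add_apply, add_smul, Finset.sum_add_distrib]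
  congr 1
  rw [Finset.sum_eq_single c]
  · simp
  · intro b _ hb; simp [hb]
  · intro h; simp at h hc; omega

/-- excursion invariant -/
def Inv (s0 : ℕ) (K : ℕ) (p : ℤ) (n : ℕ) (y : P.St) : Prop :=
  ∃ (z : P.St) (α β : ℤ → ZMod 2), Reach K (x0 P) z ∧ z.c ∈ Set.Ico p (p + n) ∧
    y.c ∈ Set.Ico p (p + n) ∧ Sim s0 y (exc z α β p n y.c)

lemma Inv.sa {s0 K n : ℕ} {p : ℤ} {y : P.St} (h : Inv s0 K p n y) (a : ZMod 2) :
    Inv s0 K p n (pa P a y) := by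
  obtain ⟨z, α, β, h1, h2, h3, h4⟩ := h
  refine ⟨z, α + Pi.single y.c a, β, h1, h2, h3, ⟨rfl, ?_, fun s hs => ?_, fun s x => ?_⟩⟩
  rotate_left
  · have hV : y.V s = (z.V + swV z.A β p n) s := h4.V s hs
    exact hV
  · have hV : row y.V s x = row (z.V + swV z.A β p n) s x := h4.row s x
    exact hV
  have hA : y.A = z.A + swA α p n := h4.A
  change y.A + a • dA y.c = z.A + swA (α + Pi.single y.c a) p n
  rw [swA_single _ _ _ _ _ h3, hA, add_assoc]

lemma Inv.sb {s0 K n : ℕ} {p : ℤ} {y : P.St} (h : Inv s0 K p n y)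
    (hn : 4 * (n : ℤ) ≤ P.L s0 + 4) (b : ZMod 2) :
    Inv s0 K p n (pb P b y) := by
  obtain ⟨z, α, β, h1, h2, h3, h4⟩ := h
  have hA : y.A = z.A + swA α p n := h4.A
  have e : (exc z α (β + Pi.single y.c b) p n y.c).V = z.V + (swV z.A β p n + b • dV z.A y.c) := by
    rw [← swV_single _ _ _ _ _ _ h3]; rfl
  have e' : (pb P b y).V = y.V + b • dV y.A y.c := rfl
  refine ⟨z, α, β + Pi.single y.c b, h1, h2, h3, ⟨rfl, hA, ?_, ?_⟩⟩
  · intro s hs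
    have hV : y.V s = (z.V + swV z.A β p n) s := h4.V s hs
    have hd : dV y.A y.c s = dV z.A y.c s := by
      unfold dV
      rw [hA, win_swA_far s _ _ _ _ _ h3]
      have := L_mono (P := P) hs
      omega
    suffices hh : (pb P b y).V s = (exc z α (β + Pi.single y.c b) p n y.c).V s from hh
    rw [e, e']
    change y.V s + b • dV y.A y.c s = z.V s + (swV z.A β p n s + b • dV z.A y.c s)
    rw [hV, hd, ← add_assoc, Pi.add_apply]
  · intro s x
    have hV : row y.V s x = row (z.V + swV z.A β p n) s x := h4.row s x
    suffices hh : row (pb P b y).V s x = row (exc z α (β + Pi.single y.c b) p n y.c).V s x from hh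
    rw [e, e', row_add, hV, ← add_assoc, row_add (z.V + _), row_smul, row_smul, row_dV, row_dV]

lemma Inv.mv {s0 K n : ℕ} {p : ℤ} {y : P.St} (h : Inv s0 K p n y) (t : ℤ)
    (ht : y.c + t ∈ Set.Ico p (p + n)) : Inv s0 K p n (pt P t y) := by
  obtain ⟨z, α, β, h1, h2, h3, h4⟩ := h
  exact ⟨z, α, β, h1, h2, ht, rfl, h4.A, h4.V, h4.row⟩

lemma Inv.step1 {s0 K n : ℕ} {p : ℤ} {y : P.St} (h : Inv s0 K p n y)
    (hn : 4 * (n : ℤ) ≤ P.L s0 + 4) (x : W × ZMod 2)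
    (ht : y.c + sg x.1.2.1 ∈ Set.Ico p (p + n)) : Inv s0 K p n (stp P x y) := by
  have h1 := (h.sb hn x.2).sa x.1.1
  have h2 := h1.mv (sg x.1.2.1) ht
  exact (h2.sa x.1.2.2.1).sb hn _

lemma Inv.done {s0 K n : ℕ} {p : ℤ} {y : P.St} (h : Inv s0 K p n y) :
    ∃ z, Reach (K + 7 * n) (x0 P) z ∧ Sim s0 y z := by
  obtain ⟨z, α, β, h1, h2, h3, h4⟩ := h
  exact ⟨_, h1.trans (reach_exc z α β p n y.c h2 h3), h4⟩

lemma inv_start {s0 K n : ℕ} {p : ℤ} {y z : P.St} (h1 : Reach K (x0 P) z) (h2 : Sim s0 y z)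
    (h : y.c ∈ Set.Ico p (p + n)) : Inv s0 K p n y := by
  refine ⟨z, 0, 0, h1, h2.c ▸ h, h, ?_⟩
  have : exc z 0 0 p n y.c = z := by
    rw [h2.c]
    apply St.ext <;> simp [exc, swA, swV]
  rw [this]; exact h2

end Par

namespace Par
variable {P : Par}

/-! ### Counting excursions -/

/-- number of changes of the anchor -/
def cnt (r : ℕ) : List (W × ZMod 2) → ℤ → ℤ → ℕ
  | [], _, _ => 0
  | x :: l, c, p =>
    if |c + sg x.1.2.1 - p| = r then 1 + cnt r l (c + sg x.1.2.1) (c + sg x.1.2.1)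
    else cnt r l (c + sg x.1.2.1) p

lemma favg_coin (F : ℤ → ℝ) :
    favg (fun x : W × ZMod 2 => F (sg x.1.2.1)) = (F 1 + F (-1)) / 2 := by
  rw [favg_prod]
  simp only [favg_const]
  rw [favg_prod]
  have : ∀ x : ZMod 2, favg (fun y : Bool × ZMod 2 × ZMod 2 => F (sg (x, y).2.1)) =
      (F 1 + F (-1)) / 2 := by
    intro x
    rw [favg_prod]
    simp only [favg_const]
    simp [favg, sg]
  refine Eq.trans ?_ (favg_const (Ω := ZMod 2) ((F 1 + F (-1)) / 2))
  congr 1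
  funext x
  exact this x

lemma cnt_avg (r : ℕ) (n : ℕ) : ∀ (c p : ℤ),
    (r : ℝ) ^ 2 * Eavg n (fun l => (cnt r l c p : ℝ)) ≤ n + ((c - p : ℤ) : ℝ) ^ 2 := by
  induction n with
  | zero => intro c p; simp [Eavg, cnt]; positivity
  | succ n ih =>
    intro c p
    rw [Eavg, ← favg_mul_left]
    have : ∀ x : W × ZMod 2, (r : ℝ) ^ 2 * Eavg n (fun l => (cnt r (x :: l) c p : ℝ)) ≤
        n + ((c + sg x.1.2.1 - p : ℤ) : ℝ) ^ 2 := by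
      intro x
      by_cases h : |c + sg x.1.2.1 - p| = r
      · simp only [cnt, if_pos h]
        push_cast
        rw [Eavg_add, Eavg_const, mul_add, mul_one]
        have h1 := ih (c + sg x.1.2.1) (c + sg x.1.2.1)
        have h2 : ((c + sg x.1.2.1 - p : ℤ) : ℝ) ^ 2 = (r : ℝ) ^ 2 := by
          rw [← sq_abs, ← Int.cast_abs, h]; simp
        push_cast at h2
        simp only [sub_self, Int.cast_zero] at h1
        rw [h2]
        nlinarith
      · simp only [cnt, if_neg h]
        exact ih _ _
    refine (favg_mono this).trans ?_
    rw [favg_coin (fun t => n + ((c + t - p : ℤ) : ℝ) ^ 2)]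
    push_cast
    nlinarith

lemma wordOf_cons_apply (x : W × ZMod 2) (l : List (W × ZMod 2)) (y : P.St) :
    (wordOf (val P) (x :: l)).1 y =
      (wordOf (val P) l).1 (stp P x y) := rfl

lemma stp_c (x : W × ZMod 2) (y : P.St) : (stp P x y).c = y.c + sg x.1.2.1 := rfl

lemma sg_abs (t : Bool) : sg t = 1 ∨ sg t = -1 := by cases t <;> simp [sg]

lemma reach_run (s0 r : ℕ) (hr : P.L s0 = 8 * r) (hr1 : 1 ≤ r) :
    ∀ (l : List (W × ZMod 2)) (K : ℕ) (p : ℤ) (y : P.St), Inv s0 K (p - r) (2 * r + 1) y →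
      |y.c - p| < r →
      ∃ z, Reach (K + 7 * (2 * r + 1) * (cnt r l y.c p + 1)) (x0 P) z ∧
        Sim s0 ((wordOf (val P) l).1 y) z := by
  intro l
  induction l with
  | nil =>
    intro K p y h _
    obtain ⟨z, h1, h2⟩ := h.done
    exact ⟨z, h1.mono (by simp [cnt]), h2⟩
  | cons x l ih =>
    intro K p y h hy
    rw [wordOf_cons_apply]
    rw [abs_lt] at hy
    have hs := sg_abs x.1.2.1
    have h' := h.step1 (by push_cast; omega) x (by
      simp only [Set.mem_Ico]; push_cast
      rcases hs with hs | hs <;> rw [hs] <;> omega)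
    by_cases hc : |y.c + sg x.1.2.1 - p| = r
    · have ec : cnt r (x :: l) y.c p = 1 + cnt r l (y.c + sg x.1.2.1) (y.c + sg x.1.2.1) := by
        rw [cnt, if_pos hc]
      obtain ⟨z, h1, h2⟩ := h'.done
      obtain ⟨z', h3, h4⟩ := ih (K + 7 * (2 * r + 1)) (y.c + sg x.1.2.1) (stp P x y)
        (inv_start h1 h2 (by rw [stp_c]; simp only [Set.mem_Ico]; push_cast; omega))
        (by rw [stp_c]; simp; omega)
      refine ⟨z', h3.mono (le_of_eq ?_), h4⟩
      rw [ec, stp_c]; ring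
    · have ec : cnt r (x :: l) y.c p = cnt r l (y.c + sg x.1.2.1) p := by
        rw [cnt, if_neg hc]
      obtain ⟨z', h3, h4⟩ := ih K p (stp P x y) h' (by
        rw [stp_c]
        refine lt_of_le_of_ne ?_ hc
        rw [abs_le]
        rcases hs with hs | hs <;> rw [hs] <;> omega)
      refine ⟨z', ?_, h4⟩
      rw [ec]; exact h3

lemma wordLength_le_reach {n : ℕ} (g : Gp P) (h : Reach n (x0 P) ((g : Equiv.Perm P.St) (x0 P))) :
    wordLength (Set.range (gen P)) g ≤ n := by
  obtain ⟨l, a, b, c⟩ := h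
  refine (wordLength_le l b ?_).trans a
  exact Subtype.ext (free_x0 l.prod.2 g.2 c)

lemma wordLength_run (s0 r : ℕ) (hr : P.L s0 = 8 * r) (hr1 : 1 ≤ r) (l : List (W × ZMod 2)) :
    wordLength (Set.range (gen P)) (wordOf (val P) l) ≤
      7 * (2 * r + 1) * (cnt r l 0 0 + 1) + corr P s0 := by
  apply wordLength_le_reach
  obtain ⟨z, h1, h2⟩ := reach_run s0 r hr hr1 l 0 0 (x0 P)
    (inv_start (Reach.refl _) ⟨rfl, rfl, fun _ _ => rfl, fun _ _ => rfl⟩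
      (by simp only [Set.mem_Ico, x0]; push_cast; omega)) (by simp [x0]; omega)
  exact (h1.trans (reach_of_sim s0 _ _ h2)).mono (by simp [x0])

/-- **Upper bound for the speed.** -/
lemma speed_le (s0 n : ℕ) : speed (Set.range (gen P)) (stepLaw (val P)) n ≤
    3 * P.L s0 + 168 * (n / (P.L s0 : ℝ)) + (corr P s0 : ℝ) := by
  set r := P.D s0 * P.q s0 with hrdef
  have hr : P.L s0 = 8 * r := by unfold L; rw [hrdef]; ring
  have hr1 : 1 ≤ r := Nat.mul_pos (P.hD _) (P.hq _)
  have hr1' : (1 : ℝ) ≤ r := by exact_mod_cast hr1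
  rw [speed_stepLaw]
  have h1 : Eavg n (fun l => (wordLength (Set.range (gen P)) (wordOf (val P) l) : ℝ)) ≤
      Eavg n (fun l => 7 * (2 * r + 1) * (cnt r l 0 0 : ℝ) + (7 * (2 * (r:ℝ) + 1) + corr P s0)) := by
    refine Eavg_mono n fun l _ => ?_
    have := wordLength_run s0 r hr hr1 l
    calc (wordLength (Set.range (gen P)) (wordOf (val P) l) : ℝ)
        ≤ ((7 * (2 * r + 1) * (cnt r l 0 0 + 1) + corr P s0 : ℕ) : ℝ) := by exact_mod_cast this
      _ = _ := by push_cast; ring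
  refine h1.trans ?_
  rw [Eavg_add, Eavg_const, Eavg_mul_left]
  have h2 := cnt_avg r n 0 0
  simp only [sub_self, Int.cast_zero] at h2
  set E := Eavg n (fun l => (cnt r l 0 0 : ℝ))
  have hE : 7 * (2 * (r:ℝ) + 1) * E ≤ 21 * (n / r) := by
    have hE0 : 0 ≤ E := Eavg_nonneg n fun l _ => by positivity
    have : (r : ℝ) * E ≤ n / r := by
      rw [le_div_iff₀ (by linarith)]
      nlinarith
    nlinarith
  have h3 : (P.L s0 : ℝ) = 8 * r := by rw [hr]; push_cast; ring
  have h4 : 168 * (n / (P.L s0 : ℝ)) = 21 * (n / r) := by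
    rw [h3]; field_simp; ring
  rw [h4]
  nlinarith

end Par

namespace Par
variable {P : Par}

/-! ### Visited sites -/

lemma favg_zmod2 (F : ZMod 2 → ℝ) : favg F = (F 0 + F 1) / 2 := by
  have : (Finset.univ : Finset (ZMod 2)) = {0, 1} := by decide
  unfold favg
  rw [this, Finset.sum_pair (by decide)]
  simp

/-- new first level lamps after a step -/
noncomputable def nA (w : W) (c : ℤ) (A : P.LampA) : P.LampA :=
  A + w.1 • dA c + w.2.2.1 • dA (c + sg w.2.1)

/-- visited sites -/
noncomputable def sites (s : ℕ) : List W → ℤ → P.LampA → List (ZMod (P.L s) × P.Pat s)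
  | [], _, _ => []
  | w :: l, c, A => ((c : ZMod _), win s A (c : ZMod _)) ::
      sites s l (c + sg w.2.1) (nA w c A)

/-- deterministic part of the second level change -/
noncomputable def kv (s : ℕ) : List W → ℤ → P.LampA → ZMod (P.L s) × P.Pat s → ZMod 2
  | [], _, _ => 0
  | w :: l, c, A => w.2.2.2 • dV (nA w c A) (c + sg w.2.1) s + kv s l (c + sg w.2.1) (nA w c A)

lemma stp_A (w : W) (b : ZMod 2) (y : P.St) : (stp P (w, b) y).A = nA w y.c y.A := rfl
lemma stp_V (w : W) (b : ZMod 2) (y : P.St) : (stp P (w, b) y).V =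
    y.V + b • dV y.A y.c + w.2.2.2 • dV (nA w y.c y.A) (y.c + sg w.2.1) := rfl

lemma run_outside (s : ℕ) (x : ZMod (P.L s) × P.Pat s) : ∀ (w : List W) (b : List (ZMod 2))
    (y : P.St), w.length = b.length → x ∉ sites s w y.c y.A →
    ((wordOf (val P) (List.zip w b)).1 y).V s x = y.V s x + kv s w y.c y.A x := by
  intro w
  induction w with
  | nil => intro b y _ _; simp [wordOf, kv]
  | cons w ws ih =>
    intro b y hb hx
    cases b with
    | nil => simp at hb
    | cons b bs =>
      rw [List.zip_cons_cons, wordOf_cons_apply]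
      simp only [sites, List.mem_cons, not_or] at hx
      rw [ih bs (stp P (w, b) y) (by simpa using hb) hx.2]
      rw [stp_V, kv]
      have h0 : dV y.A y.c s x = 0 := by
        unfold dV; rw [Pi.single_apply, if_neg hx.1]
      simp only [Pi.add_apply, Pi.smul_apply, h0, smul_zero, add_zero, add_assoc]
      rfl

lemma bits_le (s : ℕ) (v : ZMod (P.L s) × P.Pat s → ZMod 2) : ∀ (w : List W) (y : P.St),
    Eavg w.length (fun b : List (ZMod 2) =>
      if ((wordOf (val P) (List.zip w b)).1 y).V s = v then (1:ℝ) else 0) ≤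
      (1 / 2 : ℝ) ^ (sites s w y.c y.A).toFinset.card := by
  intro w
  induction w with
  | nil => intro y; simp only [List.length_nil, Eavg, sites]; split_ifs <;> simp
  | cons w ws ih =>
    intro y
    rw [List.length_cons, Eavg]
    have hstep : ∀ b : ZMod 2, (fun l : List (ZMod 2) =>
        if ((wordOf (val P) (List.zip (w :: ws) (b :: l))).1 y).V s = v then (1:ℝ) else 0) =
        fun l => if ((wordOf (val P) (List.zip ws l)).1 (stp P (w, b) y)).V s = v then (1:ℝ) else 0 :=
      fun b => rfl
    simp only [hstep]
    have hih : ∀ b : ZMod 2, Eavg ws.length (fun l =>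
        if ((wordOf (val P) (List.zip ws l)).1 (stp P (w, b) y)).V s = v then (1:ℝ) else 0) ≤
        (1 / 2 : ℝ) ^ (sites s ws (y.c + sg w.2.1) (nA w y.c y.A)).toFinset.card :=
      fun b => ih (stp P (w, b) y)
    set x : ZMod (P.L s) × P.Pat s := ((y.c : ZMod _), win s y.A (y.c : ZMod _)) with hx
    have hsites : sites s (w :: ws) y.c y.A = x :: sites s ws (y.c + sg w.2.1) (nA w y.c y.A) := rfl
    set T := sites s ws (y.c + sg w.2.1) (nA w y.c y.A) with hT
    rw [hsites, List.toFinset_cons]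
    by_cases hmem : x ∈ T.toFinset
    · rw [Finset.insert_eq_of_mem hmem]
      refine (favg_mono hih).trans ?_
      rw [favg_const]
    · rw [Finset.card_insert_of_notMem hmem, favg_zmod2]
      have hmem' : x ∉ T := by simpa using hmem
      -- only one bit works
      have key : ∀ b : ZMod 2, v x ≠ y.V s x + b +
          w.2.2.2 • dV (nA w y.c y.A) (y.c + sg w.2.1) s x +
            kv s ws (y.c + sg w.2.1) (nA w y.c y.A) x →
          Eavg ws.length (fun l =>
          if ((wordOf (val P) (List.zip ws l)).1 (stp P (w, b) y)).V s = v
            then (1:ℝ) else 0) = 0 := by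
        intro b hb
        refine Eq.trans ?_ (Eavg_zero (Ω := ZMod 2) ws.length)
        refine Eavg_congr _ fun l hl => if_neg fun hcon => hb ?_
        have h1 := run_outside s x ws l (stp P (w, b) y) hl.symm hmem'
        rw [hcon] at h1
        rw [h1, stp_V]
        have h0 : dV y.A y.c s x = 1 := by
          unfold dV; rw [Pi.single_apply, if_pos rfl]
        simp only [Pi.add_apply, Pi.smul_apply, h0, smul_eq_mul, mul_one]
        rfl
      set a := y.V s x
      set e := w.2.2.2 • dV (nA w y.c y.A) (y.c + sg w.2.1) s x
      set k := kv s ws (y.c + sg w.2.1) (nA w y.c y.A) x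
      have hor : v x ≠ a + 0 + e + k ∨ v x ≠ a + 1 + e + k := by
        have hz : ∀ v' a e k : ZMod 2, v' ≠ a + 0 + e + k ∨ v' ≠ a + 1 + e + k := by decide
        exact hz _ _ _ _
      rw [pow_succ]
      have h0 := hih 0
      have h1 := hih 1
      rcases hor with h | h
      · rw [key 0 h]; linarith
      · rw [key 1 h]; linarith

lemma entropy_ge_sites (s n : ℕ) : Real.log 2 *
    Eavg n (fun w => ((sites s w 0 (0 : P.LampA)).toFinset.card : ℝ)) ≤
      entropy (convPow (stepLaw (val P)) n) := by
  refine entropy_ge (val P) n (fun w => (sites s w 0 (0 : P.LampA)).toFinset.card) ?_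
  intro w hw g
  refine le_trans ?_ (bits_le s ((g.1 (x0 P)).V s) w (x0 P))
  rw [hw]
  refine Eavg_mono n fun b _ => ?_
  by_cases h : wordOf (val P) (List.zip w b) = g
  · rw [if_pos h, if_pos (by rw [h])]
  · rw [if_neg h]; split_ifs <;> norm_num

lemma entropy_ge_log2 (n : ℕ) (hn : 1 ≤ n) :
    Real.log 2 ≤ entropy (convPow (stepLaw (val P)) n) := by
  refine le_trans ?_ (entropy_ge_sites 0 n)
  have : (1:ℝ) ≤ Eavg n (fun w => ((sites 0 w 0 (0 : P.LampA)).toFinset.card : ℝ)) := by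
    rw [← Eavg_const (Ω := W) n 1]
    refine Eavg_mono n fun w hw => ?_
    cases w with
    | nil => simp at hw; omega
    | cons w ws =>
      have : 1 ≤ (sites 0 (w :: ws) 0 (0 : P.LampA)).toFinset.card := by
        rw [Nat.one_le_iff_ne_zero, Finset.card_ne_zero]
        rw [sites, List.toFinset_cons]
        exact Finset.insert_nonempty _ _
      exact_mod_cast this
  nlinarith [Real.log_pos (by norm_num : (1:ℝ) < 2)]

/-! ### Hitting probabilities -/

/-- probability of not visiting a site -/
noncomputable def qq (s : ℕ) (x : ZMod (P.L s) × P.Pat s) (n : ℕ) (c : ℤ) (A : P.LampA) : ℝ :=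
  Eavg n (fun w => if x ∈ sites s w c A then (0:ℝ) else 1)

lemma qq_zero (s : ℕ) (x : ZMod (P.L s) × P.Pat s) (c : ℤ) (A : P.LampA) : qq s x 0 c A = 1 := by
  simp [qq, Eavg, sites]

lemma qq_nonneg (s : ℕ) (x : ZMod (P.L s) × P.Pat s) (n : ℕ) (c : ℤ) (A : P.LampA) :
    0 ≤ qq s x n c A := Eavg_nonneg n fun w _ => by split_ifs <;> norm_num

lemma qq_le_one (s : ℕ) (x : ZMod (P.L s) × P.Pat s) (n : ℕ) (c : ℤ) (A : P.LampA) :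
    qq s x n c A ≤ 1 := by
  rw [← Eavg_const (Ω := W) n 1]
  exact Eavg_mono n fun w _ => by split_ifs <;> norm_num

lemma qq_hit (s : ℕ) (x : ZMod (P.L s) × P.Pat s) (n : ℕ) (c : ℤ) (A : P.LampA)
    (h : x = ((c : ZMod _), win s A (c : ZMod _))) : qq s x (n + 1) c A = 0 := by
  unfold qq
  refine Eq.trans ?_ (Eavg_zero (Ω := W) (n + 1))
  refine Eavg_congr _ fun w hw => if_pos ?_
  cases w with
  | nil => simp at hw
  | cons w ws => rw [sites, ← h]; simp

lemma qq_succ (s : ℕ) (x : ZMod (P.L s) × P.Pat s) (n : ℕ) (c : ℤ) (A : P.LampA)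
    (h : x ≠ ((c : ZMod _), win s A (c : ZMod _))) :
    qq s x (n + 1) c A = favg (fun w : W => qq s x n (c + sg w.2.1) (nA w c A)) := by
  unfold qq
  rw [Eavg]
  congr 1; funext w
  refine Eavg_congr _ fun l _ => ?_
  have : x ∈ sites s (w :: l) c A ↔ x ∈ sites s l (c + sg w.2.1) (nA w c A) := by
    rw [sites, List.mem_cons]
    exact or_iff_right h
  by_cases h' : x ∈ sites s l (c + sg w.2.1) (nA w c A)
  · rw [if_pos h', if_pos (this.2 h')]
  · rw [if_neg h', if_neg (fun h2 => h' (this.1 h2))]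

lemma qq_succ_le (s : ℕ) (x : ZMod (P.L s) × P.Pat s) (n : ℕ) (c : ℤ) (A : P.LampA) :
    qq s x (n + 1) c A ≤ favg (fun w : W => qq s x n (c + sg w.2.1) (nA w c A)) := by
  by_cases h : x = ((c : ZMod _), win s A (c : ZMod _))
  · rw [qq_hit s x n c A h]
    rw [← favg_const (Ω := W) 0]
    exact favg_mono fun w => qq_nonneg _ _ _ _ _
  · rw [qq_succ s x n c A h]

lemma qq_block (s : ℕ) (x : ZMod (P.L s) × P.Pat s) (m : ℕ) (κ : ℝ)
    (hκ : ∀ c A, qq s x m c A ≤ κ) (n : ℕ) : ∀ c A, qq s x (n + m) c A ≤ κ * qq s x n c A := by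
  induction n with
  | zero => intro c A; rw [zero_add, qq_zero, mul_one]; exact hκ c A
  | succ n ih =>
    intro c A
    rw [show n + 1 + m = (n + m) + 1 by ring]
    by_cases h : x = ((c : ZMod _), win s A (c : ZMod _))
    · rw [qq_hit s x _ c A h, qq_hit s x _ c A h, mul_zero]
    · rw [qq_succ s x _ c A h, qq_succ s x _ c A h, ← favg_mul_left]
      exact favg_mono fun w => ih _ _

lemma qq_pow (s : ℕ) (x : ZMod (P.L s) × P.Pat s) (m : ℕ) (κ : ℝ)
    (hκ : ∀ c A, qq s x m c A ≤ κ) (k : ℕ) : ∀ c A, qq s x (k * m) c A ≤ κ ^ k := by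
  have h0 : 0 ≤ κ := (qq_nonneg s x m 0 0).trans (hκ 0 0)
  induction k with
  | zero => intro c A; rw [zero_mul, qq_zero, pow_zero]
  | succ k ih =>
    intro c A
    rw [add_mul, one_mul, pow_succ, mul_comm (κ ^ k)]
    exact (qq_block s x m κ hκ _ c A).trans (by gcongr; exact ih c A)

/-! ### Averaging operators -/

/-- randomise the lamps in a list of positions -/
noncomputable def MM : List ℤ → (P.LampA → ℝ) → P.LampA → ℝ
  | [], F => F
  | i :: l, F => MM l (fun A => favg fun α : ZMod 2 => F (A + α • dA i))

lemma MM_mono (l : List ℤ) : ∀ {F H : P.LampA → ℝ}, (∀ A, F A ≤ H A) → ∀ A, MM l F A ≤ MM l H A := by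
  induction l with
  | nil => intro F H h; exact h
  | cons i l ih => intro F H h A; exact ih (fun A => favg_mono fun _ => h _) A

lemma MM_add (l : List ℤ) : ∀ (F H : P.LampA → ℝ) (A), MM l (fun A => F A + H A) A =
    MM l F A + MM l H A := by
  induction l with
  | nil => intros; rfl
  | cons i l ih => intro F H A; simp only [MM, favg_add, ih]

lemma MM_mul (l : List ℤ) (c : ℝ) : ∀ (F : P.LampA → ℝ) (A), MM l (fun A => c * F A) A =
    c * MM l F A := by
  induction l with
  | nil => intros; rfl
  | cons i l ih => intro F A; simp only [MM, favg_mul_left, ih]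

lemma MM_const (l : List ℤ) (c : ℝ) : ∀ A : P.LampA, MM l (fun _ => c) A = c := by
  induction l with
  | nil => intros; rfl
  | cons i l ih => intro A; simp only [MM, favg_const, ih]

lemma MM_pattern (s : ℕ) {ι : Type} (pos : ι → ZMod (P.L s)) (hpos : Function.Injective pos)
    (η : ι → ZMod 2) (l : List ℤ) : ∀ (K : Finset ι),
    (∀ k ∈ K, ∃ i ∈ l, pos k = (i : ZMod _)) → ∀ A : P.LampA,
    (1 / 2 : ℝ) ^ K.card ≤ MM l (fun A => if ∀ k ∈ K, A s (pos k) = η k then (1:ℝ) else 0) A := by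
  induction l with
  | nil =>
    intro K hK A
    have : K = ∅ := by
      rw [Finset.eq_empty_iff_forall_notMem]
      intro k hk
      obtain ⟨i, hi, _⟩ := hK k hk
      simp at hi
    subst this
    simp [MM]
  | cons i l ih =>
    intro K hK A
    have hdA : ∀ (A : P.LampA) (α : ZMod 2) k, (A + α • dA i : P.LampA) s (pos k) =
        if pos k = (i : ZMod _) then A s (pos k) + α else A s (pos k) := by
      intro A α k
      simp only [Pi.add_apply, Pi.smul_apply, dA, Pi.single_apply]
      split_ifs <;> simp
    by_cases hex : ∃ k0 ∈ K, pos k0 = (i : ZMod _)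
    · obtain ⟨k0, hk0, hp0⟩ := hex
      have hne : ∀ k, k ≠ k0 → pos k ≠ (i : ZMod _) := fun k hk h =>
        hk (hpos (h.trans hp0.symm))
      have h1 := ih (K.erase k0) (fun k hk => by
        rw [Finset.mem_erase] at hk
        obtain ⟨i', hi', hpi⟩ := hK k hk.2
        rcases List.mem_cons.1 hi' with rfl | hi'
        · exact absurd hpi (hne k hk.1)
        · exact ⟨i', hi', hpi⟩) A
      have hcard : K.card = (K.erase k0).card + 1 := (Finset.card_erase_add_one hk0).symm
      rw [hcard, pow_succ, mul_comm]
      refine (mul_le_mul_of_nonneg_left h1 (by norm_num)).trans ?_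
      rw [← MM_mul]
      refine MM_mono l (fun A => ?_) A
      rw [favg_zmod2]
      beta_reduce
      by_cases hA : ∀ k ∈ K.erase k0, A s (pos k) = η k
      · rw [if_pos hA]
        have good : ∀ α : ZMod 2, A s (pos k0) + α = η k0 →
            ∀ k ∈ K, (A + α • dA i : P.LampA) s (pos k) = η k := by
          intro α hα k hk
          rw [hdA]
          by_cases hkk : k = k0
          · subst hkk; rw [if_pos hp0, hα]
          · rw [if_neg (hne k hkk)]; exact hA k (Finset.mem_erase.2 ⟨hkk, hk⟩)
        have hor : A s (pos k0) + 0 = η k0 ∨ A s (pos k0) + 1 = η k0 := by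
          have hz : ∀ a b : ZMod 2, a + 0 = b ∨ a + 1 = b := by decide
          exact hz _ _
        rcases hor with h | h
        · rw [if_pos (good 0 h)]
          split_ifs <;> norm_num
        · rw [if_pos (good 1 h)]
          split_ifs <;> norm_num
      · rw [if_neg hA]
        split_ifs <;> norm_num
    · push Not at hex
      have h1 := ih K (fun k hk => by
        obtain ⟨i', hi', hpi⟩ := hK k hk
        rcases List.mem_cons.1 hi' with rfl | hi'
        · exact absurd hpi (hex k hk)
        · exact ⟨i', hi', hpi⟩) A
      refine h1.trans (MM_mono l (fun A => ?_) A)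
      rw [favg_zmod2]
      beta_reduce
      by_cases hA : ∀ k ∈ K, A s (pos k) = η k
      · have good : ∀ α : ZMod 2, ∀ k ∈ K, (A + α • dA i : P.LampA) s (pos k) = η k := by
          intro α k hk
          rw [hdA, if_neg (hex k hk)]; exact hA k hk
        rw [if_pos hA, if_pos (good 0), if_pos (good 1)]; norm_num
      · rw [if_neg hA]
        split_ifs <;> norm_num

end Par

namespace Par
variable {P : Par}

/-! ### A one dimensional hitting estimate -/

/-- hitting probability of the origin by simple random walk -/
noncomputable def uu : ℕ → ℕ → ℝ
  | 0, _ => 0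
  | _ + 1, 0 => 1
  | n + 1, x + 1 => (uu n x + uu n (x + 2)) / 2

lemma uu_nonneg (n : ℕ) : ∀ x, 0 ≤ uu n x := by
  induction n with
  | zero => intro x; simp [uu]
  | succ n ih =>
    intro x
    cases x with
    | zero => simp [uu]
    | succ x => rw [uu]; have := ih x; have := ih (x + 2); linarith

lemma uu_lower (d : ℕ) (hd : 1 ≤ d) (n : ℕ) : ∀ x : ℕ, x ≤ 2 * d →
    1 - (x : ℝ) / (2 * d) - (2 * (d:ℝ) ^ 2 + x * (2 * d - x)) / (2 * (d:ℝ) ^ 2) *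
      (1 - 1 / (3 * (d:ℝ) ^ 2)) ^ n ≤ uu n x := by
  have hd1 : (1:ℝ) ≤ d := by exact_mod_cast hd
  have hd0 : (0:ℝ) < d := by linarith
  have hd2 : (0:ℝ) < (d:ℝ) ^ 2 := by positivity
  have hlam : 0 ≤ 1 - 1 / (3 * (d:ℝ) ^ 2) := by
    rw [sub_nonneg, div_le_one (by positivity)]; nlinarith
  induction n with
  | zero =>
    intro x hx
    have hx' : (x:ℝ) ≤ 2 * d := by exact_mod_cast hx
    rw [pow_zero, mul_one, uu]
    have h1 : 0 ≤ (x:ℝ) / (2 * d) := by positivity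
    have h2 : 1 ≤ (2 * (d:ℝ) ^ 2 + x * (2 * d - x)) / (2 * (d:ℝ) ^ 2) := by
      rw [le_div_iff₀ (by positivity)]
      have : 0 ≤ (x:ℝ) * (2 * d - x) := mul_nonneg (by positivity) (by linarith)
      linarith
    linarith
  | succ n ih =>
    intro x hx
    set lam := 1 - 1 / (3 * (d:ℝ) ^ 2) with hlamdef
    have hpow : 0 ≤ lam ^ n := pow_nonneg hlam n
    cases x with
    | zero =>
      rw [uu]
      have : 0 ≤ (2 * (d:ℝ) ^ 2 + ((0:ℕ):ℝ) * (2 * d - ((0:ℕ):ℝ))) / (2 * (d:ℝ) ^ 2) * lam ^ (n+1) := by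
        simp; positivity
      simp at this ⊢
      linarith
    | succ x =>
      rcases hx.eq_or_lt with he | hlt
      · have he' : ((x + 1 : ℕ) : ℝ) = 2 * d := by exact_mod_cast he
        rw [he']
        refine le_trans ?_ (uu_nonneg _ _)
        rw [div_self (by positivity)]
        have : 0 ≤ (2 * (d:ℝ) ^ 2 + 2 * d * (2 * d - 2 * d)) / (2 * (d:ℝ) ^ 2) * lam ^ (n+1) := by
          simp; positivity
        linarith
      · rw [uu]
        have h1 := ih x (by omega)
        have h2 := ih (x + 2) (by omega)
        have hx' : (x:ℝ) + 2 ≤ 2 * d := by exact_mod_cast hlt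
        push_cast at h1 h2 ⊢
        set X : ℝ := (x:ℝ)
        set y : ℝ := lam ^ n
        have hQ : (2 * (d:ℝ) ^ 2 + (X + 1) * (2 * d - (X + 1))) * (1 / (3 * (d:ℝ) ^ 2)) ≤ 1 := by
          rw [mul_one_div, div_le_one (by positivity)]
          nlinarith [sq_nonneg (d - (X + 1))]
        have key : (2 * (d:ℝ) ^ 2 + X * (2 * d - X)) + (2 * (d:ℝ) ^ 2 + (X + 2) * (2 * d - (X + 2)))
            ≤ 2 * ((2 * (d:ℝ) ^ 2 + (X + 1) * (2 * d - (X + 1))) * lam) := by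
          have hk : 2 * ((2 * (d:ℝ) ^ 2 + (X + 1) * (2 * d - (X + 1))) * lam) =
              2 * (2 * (d:ℝ) ^ 2 + (X + 1) * (2 * d - (X + 1))) -
              2 * ((2 * (d:ℝ) ^ 2 + (X + 1) * (2 * d - (X + 1))) * (1 / (3 * (d:ℝ) ^ 2))) := by
            rw [hlamdef]; ring
          rw [hk]
          linarith
        have key2 := mul_le_mul_of_nonneg_right key
          (show 0 ≤ y / (2 * (d:ℝ) ^ 2) by positivity)
        have e1 : (X + 1) / (2 * d) * 2 = X / (2 * d) + (X + 2) / (2 * d) := by ring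
        have e3 : (2 * (d:ℝ) ^ 2 + X * (2 * d - X) + (2 * (d:ℝ) ^ 2 + (X + 2) * (2 * d - (X + 2)))) *
            (y / (2 * (d:ℝ) ^ 2)) = (2 * (d:ℝ) ^ 2 + X * (2 * d - X)) / (2 * (d:ℝ) ^ 2) * y +
            (2 * (d:ℝ) ^ 2 + (X + 2) * (2 * d - (X + 2))) / (2 * (d:ℝ) ^ 2) * y := by ring
        have e4 : 2 * ((2 * (d:ℝ) ^ 2 + (X + 1) * (2 * d - (X + 1))) * lam) * (y / (2 * (d:ℝ) ^ 2)) =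
          2 * ((2 * (d:ℝ) ^ 2 + (X + 1) * (2 * d - (X + 1))) / (2 * (d:ℝ) ^ 2) * lam ^ (n+1)) := by
          rw [pow_succ]; ring
        rw [e3, e4] at key2
        linarith

lemma uu_quarter (d : ℕ) (hd : 1 ≤ d) (x : ℕ) (hx : x ≤ d) : 1 / 4 ≤ uu (6 * d ^ 2) x := by
  have hd1 : (1:ℝ) ≤ d := by exact_mod_cast hd
  have hd2 : (0:ℝ) < (d:ℝ) ^ 2 := by positivity
  refine le_trans ?_ (uu_lower d hd (6 * d ^ 2) x (by omega))
  have hx' : (x:ℝ) ≤ d := by exact_mod_cast hx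
  have hlam : 0 ≤ 1 - 1 / (3 * (d:ℝ) ^ 2) := by
    rw [sub_nonneg, div_le_one (by positivity)]; nlinarith
  have h1 : (x:ℝ) / (2 * d) ≤ 1 / 2 := by
    rw [div_le_div_iff₀ (by positivity) (by norm_num)]; linarith
  have h2 : (2 * (d:ℝ) ^ 2 + x * (2 * d - x)) / (2 * (d:ℝ) ^ 2) ≤ 3 / 2 := by
    rw [div_le_div_iff₀ (by positivity) (by norm_num)]
    nlinarith [sq_nonneg ((d:ℝ) - x)]
  have h3 : (1 - 1 / (3 * (d:ℝ) ^ 2)) ^ (6 * d ^ 2) ≤ 1 / 6 := by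
    have ha : 1 - 1 / (3 * (d:ℝ) ^ 2) ≤ Real.exp (- (1 / (3 * (d:ℝ) ^ 2))) := by
      have := Real.add_one_le_exp (- (1 / (3 * (d:ℝ) ^ 2))); linarith
    refine (pow_le_pow_left₀ hlam ha _).trans ?_
    rw [← Real.exp_nat_mul]
    have : ((6 * d ^ 2 : ℕ) : ℝ) * -(1 / (3 * (d:ℝ) ^ 2)) = -2 := by
      push_cast; field_simp; norm_num
    rw [this, Real.exp_neg, one_div]
    apply inv_anti₀ (by norm_num)
    have h27 := Real.exp_one_gt_d9
    have : Real.exp 2 = Real.exp 1 * Real.exp 1 := by rw [← Real.exp_add]; norm_num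
    rw [this]; nlinarith
  have h4 : (2 * (d:ℝ) ^ 2 + x * (2 * d - x)) / (2 * (d:ℝ) ^ 2) *
      (1 - 1 / (3 * (d:ℝ) ^ 2)) ^ (6 * d ^ 2) ≤ 3 / 2 * (1 / 6) :=
    mul_le_mul h2 h3 (pow_nonneg hlam _) (by norm_num)
  linarith

/-! ### Hitting a site -/

lemma favg_bool (F : Bool → ℝ) : favg F = (F true + F false) / 2 := by
  simp [favg]

lemma favg_W (F : ZMod 2 → ℤ → ZMod 2 → ℝ) :
    favg (fun w : W => F w.1 (sg w.2.1) w.2.2.1) =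
      (favg (fun a => favg fun b => F a 1 b) + favg (fun a => favg fun b => F a (-1) b)) / 2 := by
  rw [favg_prod]
  have : ∀ a : ZMod 2, favg (fun y : Bool × ZMod 2 × ZMod 2 => F (a, y).1 (sg (a, y).2.1) (a, y).2.2.1)
      = (1 / 2) * (favg fun b => F a 1 b) + (1 / 2) * (favg fun b => F a (-1) b) := by
    intro a
    rw [favg_prod, favg_bool]
    have h2 : ∀ t : Bool, favg (fun y : ZMod 2 × ZMod 2 =>
        F (a, (t, y)).1 (sg (a, (t, y)).2.1) (a, (t, y)).2.2.1) = favg fun b => F a (sg t) b := by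
      intro t
      rw [favg_prod]
      simp only [favg_const]
    rw [h2, h2]
    simp only [sg, if_true]
    norm_num
    ring
  have h3 := congrArg favg (funext this)
  refine h3.trans ?_
  rw [favg_add, favg_mul_left, favg_mul_left]
  ring

lemma hit_lower (s : ℕ) (ξ : ZMod (P.L s)) (η : P.Pat s) (cd : ℤ) (hcd : (cd : ZMod _) = ξ) (n : ℕ) :
    ∀ (k : ℕ) (l : List ℤ) (c : ℤ) (A : P.LampA), cd = c + k →
    (∀ j : Fin (P.D s), ∃ i : ℤ, (i ∈ l ∨ (c ≤ i ∧ i < cd)) ∧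
      ξ + (P.h s : ZMod (P.L s)) + ((j : ℕ) : ZMod (P.L s)) = (i : ZMod _)) →
    (1 / 2 : ℝ) ^ P.D s * uu n k ≤ MM l (fun A => 1 - qq s (ξ, η) n c A) A := by
  induction n with
  | zero =>
    intro k l c A _ _
    simp only [qq_zero, sub_self, uu, mul_zero, MM_const, le_refl]
  | succ n ih =>
    intro k l c A hk hcov
    cases k with
    | zero =>
      have hc : c = cd := by simpa using hk.symm
      subst hc
      rw [uu, mul_one]
      set pos : Fin (P.D s) → ZMod (P.L s) := fun j =>
        ξ + (P.h s : ZMod (P.L s)) + ((j : ℕ) : ZMod (P.L s)) with hpos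
      have hinj : Function.Injective pos := by
        intro k k' hkk
        have h1 : ((k : ℕ) : ZMod (P.L s)) = ((k' : ℕ) : ZMod (P.L s)) := add_left_cancel hkk
        rw [ZMod.natCast_eq_natCast_iff'] at h1
        have h2 := D_le (P := P) s
        have := k.2; have := k'.2
        rw [Nat.mod_eq_of_lt (by omega), Nat.mod_eq_of_lt (by omega)] at h1
        exact Fin.ext h1
      have h1 := MM_pattern s pos hinj η l Finset.univ (fun j _ => by
        obtain ⟨i, hi, hi2⟩ := hcov j
        rcases hi with hi | hi
        · exact ⟨i, hi, hi2⟩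
        · omega) A
      rw [Finset.card_univ, Fintype.card_fin] at h1
      refine h1.trans (MM_mono l (fun A => ?_) A)
      by_cases hA : ∀ k ∈ Finset.univ, A s (pos k) = η k
      · rw [if_pos hA, qq_hit]
        · norm_num
        · rw [hcd]
          refine Prod.ext rfl ?_
          funext k
          exact (hA k (Finset.mem_univ _)).symm
      · rw [if_neg hA]
        have := qq_le_one s (ξ, η) (n + 1) c A
        linarith
    | succ k =>
      push_cast at hk
      have h1 := ih k ((c + 1) :: c :: l) (c + 1) A (by omega) (fun j => by
        obtain ⟨i, hi, hi2⟩ := hcov j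
        refine ⟨i, ?_, hi2⟩
        simp only [List.mem_cons]
        rcases hi with hi | hi
        · tauto
        · omega)
      have h2 := ih (k + 2) ((c + -1) :: c :: l) (c + -1) A (by push_cast; omega) (fun j => by
        obtain ⟨i, hi, hi2⟩ := hcov j
        refine ⟨i, ?_, hi2⟩
        simp only [List.mem_cons]
        rcases hi with hi | hi
        · tauto
        · omega)
      rw [uu]
      simp only [MM] at h1 h2
      have h3 : ∀ A : P.LampA,
          (1 / 2) * (favg fun a : ZMod 2 => favg fun b : ZMod 2 =>
            1 - qq s (ξ, η) n (c + 1) (A + a • dA c + b • dA (c + 1))) +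
          (1 / 2) * (favg fun a : ZMod 2 => favg fun b : ZMod 2 =>
            1 - qq s (ξ, η) n (c + -1) (A + a • dA c + b • dA (c + -1))) ≤
          1 - qq s (ξ, η) (n + 1) c A := by
        intro A
        have h4 := qq_succ_le s (ξ, η) n c A
        have h5 := favg_W (fun a t b => 1 - qq s (ξ, η) n (c + t) (A + a • dA c + b • dA (c + t)))
        have h6 : favg (fun w : W => 1 - qq s (ξ, η) n (c + sg w.2.1) (nA w c A)) =
            1 - favg (fun w : W => qq s (ξ, η) n (c + sg w.2.1) (nA w c A)) := by
          have := favg_add (fun w : W => 1 - qq s (ξ, η) n (c + sg w.2.1) (nA w c A))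
            (fun w : W => qq s (ξ, η) n (c + sg w.2.1) (nA w c A))
          simp only [sub_add_cancel, favg_const] at this
          linarith
        have h7 : favg (fun w : W => 1 - qq s (ξ, η) n (c + sg w.2.1) (nA w c A)) = _ := h5
        linarith
      refine le_trans ?_ (MM_mono l h3 A)
      rw [MM_add, MM_mul, MM_mul]
      nlinarith

lemma qq_T (s : ℕ) (x : ZMod (P.L s) × P.Pat s) (c : ℤ) (A : P.LampA) :
    qq s x (24 * P.L s ^ 2) c A ≤ 1 - (1 / 2 : ℝ) ^ P.D s / 4 := by
  obtain ⟨ξ, η⟩ := x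
  have hL := P.L_pos s
  obtain ⟨X, rfl⟩ := ZMod.intCast_surjective ξ
  have hL' : (0:ℤ) < P.L s := by exact_mod_cast hL
  have m1 := Int.emod_nonneg (X - c) hL'.ne'
  have m2 := Int.emod_lt_of_pos (X - c) hL'
  have m3 := Int.emod_add_mul_ediv (X - c) (P.L s)
  set m := (X - c) % (P.L s) with hm
  set k : ℕ := (m + P.L s).toNat with hk
  have hcd : ((c + k : ℤ) : ZMod (P.L s)) = (X : ZMod _) := by
    rw [ZMod.intCast_eq_intCast_iff_dvd_sub]
    refine ⟨(X - c) / (P.L s) - 1, ?_⟩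
    have : (k : ℤ) = m + P.L s := by omega
    rw [this]; linarith
  have h := hit_lower s (X : ZMod _) η (c + k) hcd (24 * P.L s ^ 2) k [] c A rfl (fun j => by
    have hY : ∃ Y : ℤ, (Y : ZMod (P.L s)) =
        (X : ZMod _) + (P.h s : ZMod (P.L s)) + ((j : ℕ) : ZMod (P.L s)) :=
      ZMod.intCast_surjective _
    obtain ⟨Y, hY⟩ := hY
    refine ⟨c + (Y - c) % (P.L s), Or.inr ?_, ?_⟩
    · have h1 := Int.emod_nonneg (Y - c) hL'.ne'
      have h2 := Int.emod_lt_of_pos (Y - c) hL'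
      constructor <;> omega
    · rw [← hY, ZMod.intCast_eq_intCast_iff_dvd_sub]
      have := Int.emod_add_mul_ediv (Y - c) (P.L s)
      exact ⟨-((Y - c) / (P.L s)), by linarith⟩)
  have h2 := uu_quarter (2 * P.L s) (by omega) k (by omega)
  rw [show 6 * (2 * P.L s) ^ 2 = 24 * P.L s ^ 2 by ring] at h2
  simp only [MM] at h
  have h3 : (0:ℝ) < (1 / 2) ^ P.D s := by positivity
  nlinarith

lemma qq_half (s : ℕ) (x : ZMod (P.L s) × P.Pat s) (n : ℕ)
    (hn : 96 * P.L s ^ 2 * 2 ^ P.D s ≤ n) (c : ℤ) (A : P.LampA) : qq s x n c A ≤ 1 / 2 := by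
  have h1 := qq_pow s x _ _ (qq_T s x) (4 * 2 ^ P.D s)
  have hhalf : (1 - (1 / 2 : ℝ) ^ P.D s / 4) ^ (4 * 2 ^ P.D s) ≤ 1 / 2 := by
    have hp : (1 / 2 : ℝ) ^ P.D s ≤ 1 := pow_le_one₀ (by norm_num) (by norm_num)
    have ha : 1 - (1 / 2 : ℝ) ^ P.D s / 4 ≤ Real.exp (-((1 / 2 : ℝ) ^ P.D s / 4)) := by
      have := Real.add_one_le_exp (-((1 / 2 : ℝ) ^ P.D s / 4)); linarith
    refine (pow_le_pow_left₀ (by linarith) ha _).trans ?_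
    rw [← Real.exp_nat_mul]
    have : ((4 * 2 ^ P.D s : ℕ) : ℝ) * -((1 / 2 : ℝ) ^ P.D s / 4) = -1 := by
      push_cast
      have : (2:ℝ) ^ P.D s * (1 / 2) ^ P.D s = 1 := by rw [← mul_pow]; norm_num
      linear_combination (-1) * this
    rw [this, Real.exp_neg, one_div]
    apply inv_anti₀ (by norm_num)
    have h27 := Real.exp_one_gt_d9
    linarith
  have h2 : ∀ c A, qq s x (96 * P.L s ^ 2 * 2 ^ P.D s) c A ≤ 1 / 2 := fun c A => by
    have := h1 c A
    rw [show 4 * 2 ^ P.D s * (24 * P.L s ^ 2) = 96 * P.L s ^ 2 * 2 ^ P.D s by ring] at this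
    exact this.trans hhalf
  have h3 := qq_block s x _ _ h2 (n - 96 * P.L s ^ 2 * 2 ^ P.D s) c A
  rw [Nat.sub_add_cancel hn] at h3
  have := qq_le_one s x (n - 96 * P.L s ^ 2 * 2 ^ P.D s) c A
  linarith

/-- **Lower bound for the entropy.** -/
lemma entropy_lower (s n : ℕ) (hn : 96 * P.L s ^ 2 * 2 ^ P.D s ≤ n) :
    Real.log 2 * ((P.L s : ℝ) * 2 ^ P.D s / 2) ≤ entropy (convPow (stepLaw (val P)) n) := by
  refine le_trans ?_ (entropy_ge_sites s n)
  apply mul_le_mul_of_nonneg_left _ (Real.log_pos (by norm_num)).le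
  have e1 : ∀ w : List W, ((sites s w 0 (0 : P.LampA)).toFinset.card : ℝ) =
      ∑ x : ZMod (P.L s) × P.Pat s, (1 + (-1) * (if x ∈ sites s w 0 (0 : P.LampA) then (0:ℝ) else 1)) := by
    intro w
    have : ∀ x : ZMod (P.L s) × P.Pat s,
        (1 + (-1) * (if x ∈ sites s w 0 (0 : P.LampA) then (0:ℝ) else 1)) =
        if x ∈ (sites s w 0 (0 : P.LampA)).toFinset then 1 else 0 := by
      intro x
      by_cases h : x ∈ sites s w 0 (0 : P.LampA)
      · rw [if_pos h, if_pos (List.mem_toFinset.2 h)]; norm_num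
      · rw [if_neg h, if_neg (fun h' => h (List.mem_toFinset.1 h'))]; norm_num
    simp only [this]
    rw [Finset.sum_ite_mem]
    simp
  simp only [e1]
  rw [Eavg_sum]
  have e2 : ∀ x : ZMod (P.L s) × P.Pat s, (1 / 2 : ℝ) ≤
      Eavg n (fun w => (1 + (-1) * (if x ∈ sites s w 0 (0 : P.LampA) then (0:ℝ) else 1))) := by
    intro x
    rw [Eavg_add, Eavg_const, Eavg_mul_left]
    have := qq_half s x n hn 0 0
    unfold qq at this
    linarith
  refine le_trans (le_of_eq ?_) (Finset.sum_le_sum fun x _ => e2 x)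
  rw [Finset.sum_const, Finset.card_univ, Fintype.card_prod, Fintype.card_fun, ZMod.card, ZMod.card,
    Fintype.card_fin, nsmul_eq_mul]
  push_cast
  ring

end Par

/-- Dyadic data extracted from the prescribed function. -/
structure Dy (g : ℕ → ℝ) (A : ℕ) : Prop where
  zero : g 0 = 1
  step : ∀ t, 3 / 2 * g t ≤ g (t + 1)
  jump : ∀ t, 2 * g (t + A) ≤ 2 ^ A * g t
  four : ∀ t, (8:ℝ) ^ t ≤ g t ^ 4

namespace Dy
variable {g : ℕ → ℝ} {A : ℕ}

lemma pos (h : Dy g A) (t : ℕ) : 0 < g t := by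
  induction t with
  | zero => rw [h.zero]; norm_num
  | succ t ih => linarith [h.step t]

lemma base (h : Dy g A) (e : ℕ) : (2:ℝ) ^ e * g (A * e) ≤ 2 ^ (A * e) := by
  induction e with
  | zero => simp [h.zero]
  | succ e ih =>
    have h1 := h.jump (A * e)
    calc (2:ℝ) ^ (e + 1) * g (A * (e + 1)) = 2 ^ e * (2 * g (A * e + A)) := by
          rw [pow_succ, Nat.mul_succ]; ring
      _ ≤ 2 ^ e * (2 ^ A * g (A * e)) := by gcongr
      _ = 2 ^ A * (2 ^ e * g (A * e)) := by ring
      _ ≤ 2 ^ A * 2 ^ (A * e) := by gcongr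
      _ = 2 ^ (A * (e + 1)) := by rw [← pow_add]; congr 1; ring

lemma ex (h : Dy g A) (e : ℕ) : ∃ t, (2:ℝ) ^ e * g t ≤ 2 ^ t := ⟨_, h.base e⟩

/-- Crossing time. -/
noncomputable def T (h : Dy g A) (e : ℕ) : ℕ := Nat.find (h.ex e)

lemma T_spec (h : Dy g A) (e : ℕ) : (2:ℝ) ^ e * g (h.T e) ≤ 2 ^ (h.T e) := Nat.find_spec (h.ex e)

lemma T_le_of (h : Dy g A) {e t : ℕ} (ht : (2:ℝ) ^ e * g t ≤ 2 ^ t) : h.T e ≤ t :=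
  Nat.find_min' (h.ex e) ht

lemma T_le (h : Dy g A) (e : ℕ) : h.T e ≤ A * e := h.T_le_of (h.base e)

lemma T_ge (h : Dy g A) (e : ℕ) : 4 * e ≤ h.T e := by
  set t := h.T e with ht
  have h1 : (2:ℝ) ^ e * g t ≤ 2 ^ t := h.T_spec e
  have h2 := h.four t
  have hp := h.pos t
  have h3 : ((2:ℝ) ^ e * g t) ^ 4 ≤ (2 ^ t) ^ 4 := by gcongr
  have h4 : (2:ℝ) ^ (4 * e) * 8 ^ t ≤ 2 ^ t * 8 ^ t := by
    calc (2:ℝ) ^ (4 * e) * 8 ^ t ≤ 2 ^ (4 * e) * g t ^ 4 := by gcongr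
      _ = ((2:ℝ) ^ e * g t) ^ 4 := by rw [mul_pow, ← pow_mul, mul_comm 4 e]
      _ ≤ (2 ^ t) ^ 4 := h3
      _ = 2 ^ t * 8 ^ t := by
        rw [← mul_pow, ← pow_mul, mul_comm t 4, pow_mul]; norm_num
  have h5 : (2:ℝ) ^ (4 * e) ≤ 2 ^ t := le_of_mul_le_mul_right h4 (by positivity)
  exact (pow_le_pow_iff_right₀ (by norm_num : (1:ℝ) < 2)).1 h5

lemma T_upper (h : Dy g A) (e : ℕ) (he : 1 ≤ e) : (2:ℝ) ^ (h.T e) ≤ 2 * (2 ^ e * g (h.T e)) := by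
  have h1 := h.T_ge e
  obtain ⟨t, ht⟩ : ∃ t, h.T e = t + 1 := ⟨h.T e - 1, by omega⟩
  have h2 : ¬ ((2:ℝ) ^ e * g t ≤ 2 ^ t) := fun h' => by have := h.T_le_of h'; omega
  rw [ht, pow_succ]
  have h3 := h.step t
  have h4 := h.pos t
  have h5 : (2:ℝ) ^ e * g t ≤ 2 ^ e * g (t + 1) := by gcongr; linarith
  push Not at h2
  linarith

lemma T_lt (h : Dy g A) (e : ℕ) : h.T e < h.T (e + 1) := by
  have h1 := h.T_ge (e + 1)
  obtain ⟨t, ht⟩ : ∃ t, h.T (e + 1) = t + 1 := ⟨h.T (e + 1) - 1, by omega⟩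
  have h2 := h.T_spec (e + 1)
  rw [ht, pow_succ, pow_succ] at h2
  have h3 := h.step t
  have h4 := h.pos t
  have h5 : (2:ℝ) ^ e * g t ≤ 2 ^ e * g (t + 1) := by gcongr; linarith
  have h6 : h.T e ≤ t := h.T_le_of (by linarith)
  omega

lemma T_step (h : Dy g A) (e : ℕ) : h.T (e + 1) ≤ h.T e + A := by
  apply h.T_le_of
  have h1 := h.T_spec e
  have h2 := h.jump (h.T e)
  calc (2:ℝ) ^ (e + 1) * g (h.T e + A) = 2 ^ e * (2 * g (h.T e + A)) := by ring
    _ ≤ 2 ^ e * (2 ^ A * g (h.T e)) := by gcongr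
    _ = 2 ^ A * (2 ^ e * g (h.T e)) := by ring
    _ ≤ 2 ^ A * 2 ^ (h.T e) := by gcongr
    _ = 2 ^ (h.T e + A) := by rw [← pow_add, add_comm]

/-- The selected parameters. -/
structure Sel (g : ℕ → ℝ) (A e0 : ℕ) (P : Par) (t : ℕ → ℕ) : Prop where
  L_le : ∀ s, (P.L s : ℝ) ≤ 2 ^ (e0 + 3 * s)
  L_ge : ∀ s, (2:ℝ) ^ (e0 + 3 * s) ≤ 2 * P.L s
  Deq : ∀ s, (2:ℝ) ^ (P.D s) * (2 ^ (e0 + 3 * s)) ^ 2 = 2 ^ (t s)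
  lo : ∀ s, (2:ℝ) ^ (e0 + 3 * s) * g (t s) ≤ 2 ^ (t s)
  hi : ∀ s, (2:ℝ) ^ (t s) ≤ 2 * (2 ^ (e0 + 3 * s) * g (t s))
  four : ∀ s, 4 * (e0 + 3 * s) ≤ t s
  lt : ∀ s, t s < t (s + 1)
  le : ∀ s, t (s + 1) ≤ t s + 3 * A
  t0 : t 0 ≤ A * e0

lemma exists_sel (h : Dy g A) (e0 : ℕ) (he0 : 1 ≤ e0) (hlin : ∀ e, e0 ≤ e → 16 * (A * e) ≤ 2 ^ e) :
    ∃ P t, Sel g A e0 P t := by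
  have hge := h.T_ge
  have hle := h.T_le
  have hDle : ∀ s, 16 * (h.T (e0 + 3 * s) - 2 * (e0 + 3 * s)) ≤ 2 ^ (e0 + 3 * s) := fun s => by
    have := hlin (e0 + 3 * s) (by omega)
    have := hle (e0 + 3 * s)
    omega
  have hDpos : ∀ s, 1 ≤ h.T (e0 + 3 * s) - 2 * (e0 + 3 * s) := fun s => by
    have := hge (e0 + 3 * s)
    omega
  have hL1 : ∀ k D : ℕ, 8 * D * (k / (8 * D)) ≤ k := fun k D => Nat.mul_div_le _ _
  have hL2 : ∀ k D : ℕ, 1 ≤ D → 16 * D ≤ k → k ≤ 2 * (8 * D * (k / (8 * D))) := fun k D hD hk => by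
    have h1 := Nat.div_add_mod k (8 * D)
    have h2 := Nat.mod_lt k (show 0 < 8 * D by omega)
    omega
  let P : Par :=
    { D := fun s => h.T (e0 + 3 * s) - 2 * (e0 + 3 * s)
      q := fun s => 2 ^ (e0 + 3 * s) / (8 * (h.T (e0 + 3 * s) - 2 * (e0 + 3 * s)))
      hD := hDpos
      hq := fun s => by
        have h1 := hDle s
        have h2 := hDpos s
        rw [Nat.one_le_div_iff (by omega)]
        omega
      grow := fun s => by
        have h1 := hL1 (2 ^ (e0 + 3 * s)) (h.T (e0 + 3 * s) - 2 * (e0 + 3 * s))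
        have h2 := hL2 (2 ^ (e0 + 3 * (s + 1))) (h.T (e0 + 3 * (s + 1)) - 2 * (e0 + 3 * (s + 1)))
          (hDpos _) (hDle _)
        have h3 : 2 ^ (e0 + 3 * (s + 1)) = 8 * 2 ^ (e0 + 3 * s) := by
          rw [show e0 + 3 * (s + 1) = (e0 + 3 * s) + 3 by ring, pow_add]; ring
        omega }
  refine ⟨P, fun s => h.T (e0 + 3 * s), ?_, ?_, ?_, fun s => h.T_spec _, fun s => h.T_upper _ (by omega),
    fun s => hge _, ?_, ?_, hle _⟩
  · intro s
    have := hL1 (2 ^ (e0 + 3 * s)) (h.T (e0 + 3 * s) - 2 * (e0 + 3 * s))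
    exact_mod_cast this
  · intro s
    have := hL2 (2 ^ (e0 + 3 * s)) (h.T (e0 + 3 * s) - 2 * (e0 + 3 * s)) (hDpos _) (hDle _)
    exact_mod_cast this
  · intro s
    rw [← pow_mul, ← pow_add]
    congr 1
    have := hge (e0 + 3 * s)
    change h.T (e0 + 3 * s) - 2 * (e0 + 3 * s) + (e0 + 3 * s) * 2 = h.T (e0 + 3 * s)
    omega
  · intro s
    have h1 := h.T_lt (e0 + 3 * s)
    have h2 := h.T_lt (e0 + 3 * s + 1)
    have h3 := h.T_lt (e0 + 3 * s + 2)
    exact h1.trans (h2.trans h3)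
  · intro s
    have h1 := h.T_step (e0 + 3 * s)
    have h2 := h.T_step (e0 + 3 * s + 1)
    have h3 := h.T_step (e0 + 3 * s + 2)
    change h.T (e0 + 3 * s + 2 + 1) ≤ h.T (e0 + 3 * s) + 3 * A
    change h.T (e0 + 3 * s + 2) ≤ _ at h2
    omega

end Dy

/-- Real-variable consequences of the growth condition. -/
structure Gr (f : ℝ → ℝ) : Prop where
  one : ∀ x, 1 ≤ x → 1 ≤ f x
  mono : ∀ x y, 1 ≤ x → x ≤ y → f x ≤ f y
  sub : ∀ x y, 1 ≤ x → x ≤ y → x * f y ≤ y * f x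

section final
variable {f : ℝ → ℝ} {A e0 : ℕ} {P : Par} {t : ℕ → ℕ}

lemma sel_ge_self (hs : Dy.Sel (fun t => f (2 ^ t)) A e0 P t) (s : ℕ) : s ≤ t s := by
  have := hs.four s; omega

lemma one_le_twoPow (t : ℕ) : (1:ℝ) ≤ 2 ^ t := one_le_pow₀ (by norm_num)

lemma corr_bound (hf : Gr f) (hd : Dy (fun t => f (2 ^ t)) A)
    (hs : Dy.Sel (fun t => f (2 ^ t)) A e0 P t) (s : ℕ) :
    ((Par.corr P (s + 1) : ℕ) : ℝ) ≤ 54 * f (2 ^ (t s)) := by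
  have term : ∀ s, ((2 ^ P.D s * (9 * P.L s) : ℕ) : ℝ) ≤ 18 * f (2 ^ t s) := by
    intro s
    have h1 := hs.L_le s
    have h2 := hs.Deq s
    have h3 := hs.hi s
    have hk : (0:ℝ) < 2 ^ (e0 + 3 * s) := by positivity
    push_cast
    set k : ℝ := 2 ^ (e0 + 3 * s)
    have h4 : (2:ℝ) ^ P.D s * k ≤ 2 * f (2 ^ t s) := by
      have : (2 ^ P.D s * k) * k ≤ (2 * f (2 ^ t s)) * k := by nlinarith
      exact le_of_mul_le_mul_right this hk
    have h5 : (2:ℝ) ^ P.D s * P.L s ≤ 2 ^ P.D s * k := by gcongr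
    linarith
  induction s with
  | zero =>
    rw [Par.corr, Finset.sum_range_one]
    have := hf.one _ (one_le_twoPow (t 0))
    linarith [term 0]
  | succ s ih =>
    have e : Par.corr P (s + 1 + 1) = Par.corr P (s + 1) + 2 ^ P.D (s+1) * (9 * P.L (s+1)) := by
      rw [Par.corr, Finset.sum_range_succ, ← Par.corr]
    rw [e, Nat.cast_add]
    have h1 := term (s + 1)
    have h2 := hd.step (t s)
    have h3 : f (2 ^ (t s + 1)) ≤ f (2 ^ t (s + 1)) :=
      hf.mono _ _ (one_le_twoPow _) (pow_le_pow_right₀ (by norm_num) (hs.lt s))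
    linarith

lemma speed_final (he0 : 1 ≤ e0) (hf : Gr f) (hd : Dy (fun t => f (2 ^ t)) A)
    (hs : Dy.Sel (fun t => f (2 ^ t)) A e0 P t) (n : ℕ) (hn : 1 ≤ n) :
    speed (Set.range (Par.gen P)) (stepLaw (Par.val P)) n ≤ (3 * 2 ^ e0 + 750) * f n := by
  have hn1 : (1:ℝ) ≤ n := by exact_mod_cast hn
  have hfn := hf.one n hn1
  have hex : ∃ s, n < 2 ^ (t s) := ⟨n, Nat.lt_of_lt_of_le Nat.lt_two_pow_self
    (Nat.pow_le_pow_right (by norm_num) (sel_ge_self hs n))⟩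
  set s0 := Nat.find hex with hs0
  have hlt : (n:ℝ) < 2 ^ (t s0) := by exact_mod_cast Nat.find_spec hex
  have main := Par.speed_le (P := P) s0 n
  have hLp : (0:ℝ) < P.L s0 := by exact_mod_cast P.L_pos s0
  have h1 : (n:ℝ) / P.L s0 ≤ 4 * f n := by
    rw [div_le_iff₀ hLp]
    have a1 := hf.sub n _ hn1 hlt.le
    have a2 := hs.hi s0
    have a3 := hs.L_ge s0
    have a4 := hf.one _ (one_le_twoPow (t s0))
    set k : ℝ := 2 ^ (e0 + 3 * s0)
    set m : ℝ := 2 ^ (t s0)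
    have a5 : (n:ℝ) * f m ≤ (2 * k * f n) * f m := by nlinarith
    have a6 : (n:ℝ) ≤ 2 * k * f n := le_of_mul_le_mul_right a5 (by linarith)
    nlinarith
  have h2 : 3 * (P.L s0 : ℝ) + Par.corr P s0 ≤ (3 * 2 ^ e0 + 78) * f n := by
    have hp0 : (0:ℝ) < 2 ^ e0 := by positivity
    have b1 := hs.L_le s0
    rcases Nat.eq_zero_or_eq_succ_pred s0 with h0 | h0
    · rw [h0] at b1 ⊢
      have : Par.corr P 0 = 0 := by simp [Par.corr]
      rw [this]
      simp only [Nat.mul_zero, Nat.add_zero] at b1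
      push_cast
      nlinarith
    · obtain ⟨s, hs1⟩ : ∃ s, s0 = s + 1 := ⟨_, h0⟩
      have b2 : ¬ n < 2 ^ (t s) := Nat.find_min hex (by omega)
      have b3 : (2:ℝ) ^ (t s) ≤ n := by
        push Not at b2
        exact_mod_cast b2
      have b4 := hf.mono _ _ (one_le_twoPow (t s)) b3
      have b5 := corr_bound hf hd hs s
      have b6 : (2:ℝ) ^ (e0 + 3 * s) ≤ f (2 ^ t s) := by
        have c1 := hs.hi s
        have c2 : (2:ℝ) ^ (4 * (e0 + 3 * s)) ≤ 2 ^ t s :=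
          pow_le_pow_right₀ (by norm_num) (hs.four s)
        have c3 : (2:ℝ) ≤ 2 ^ (e0 + 3 * s) := by
          calc (2:ℝ) = 2 ^ 1 := by norm_num
            _ ≤ _ := pow_le_pow_right₀ (by norm_num) (by omega)
        rw [mul_comm 4, pow_mul] at c2
        set k : ℝ := 2 ^ (e0 + 3 * s)
        have c4 : 2 * k * k ≤ k ^ 4 := by
          have : 2 * k * k ≤ k * k * k * k := by
            have : (2:ℝ) ≤ k * k := by nlinarith
            nlinarith [mul_nonneg (show 0 ≤ k by linarith) (show 0 ≤ k by linarith)]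
          calc _ ≤ _ := this
            _ = _ := by ring
        have c5 : 2 * k * k ≤ 2 * k * f (2 ^ t s) := by linarith
        exact le_of_mul_le_mul_left c5 (by linarith)
      rw [hs1] at b1 ⊢
      have b7 : (2:ℝ) ^ (e0 + 3 * (s + 1)) = 8 * 2 ^ (e0 + 3 * s) := by
        rw [show e0 + 3 * (s + 1) = (e0 + 3 * s) + 3 by ring, pow_add]; ring
      have : 0 ≤ 3 * 2 ^ e0 * f n := by positivity
      nlinarith
  linarith

lemma entropy_final (hf : Gr f)
    (hs : Dy.Sel (fun t => f (2 ^ t)) A e0 P t) (n : ℕ) (hn : 1 ≤ n) (hf1 : f 1 = 1) :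
    f n ≤ (192 * 2 ^ (A * e0) + 768 * 8 ^ A) * entropy (convPow (stepLaw (Par.val P)) n) := by
  have hn1 : (1:ℝ) ≤ n := by exact_mod_cast hn
  have hlog : (1:ℝ) / 2 ≤ Real.log 2 := by linarith [Real.log_two_gt_d9]
  have hH := Par.entropy_ge_log2 (P := P) n hn
  have hex : ∃ s, n < 96 * 2 ^ (t s) := ⟨n, by
    have : n < 2 ^ t n := Nat.lt_of_lt_of_le Nat.lt_two_pow_self
      (Nat.pow_le_pow_right (by norm_num) (sel_ge_self hs n))
    omega⟩
  set s0 := Nat.find hex with hs0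
  have hlt : (n:ℝ) < 96 * 2 ^ (t s0) := by exact_mod_cast Nat.find_spec hex
  have hp1 : (0:ℝ) < 2 ^ (A * e0) := by positivity
  have hp2 : (0:ℝ) < 8 ^ A := by positivity
  set H := entropy (convPow (stepLaw (Par.val P)) n)
  rcases Nat.eq_zero_or_eq_succ_pred s0 with h0 | h0
  · rw [h0] at hlt
    have a1 := hf.sub 1 n le_rfl hn1
    rw [hf1] at a1
    have a2 : (2:ℝ) ^ (t 0) ≤ 2 ^ (A * e0) := pow_le_pow_right₀ (by norm_num) hs.t0
    have : 192 * (2:ℝ) ^ (A * e0) * (1/2) ≤ 192 * 2 ^ (A * e0) * H := by gcongr; linarith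
    have : 0 ≤ 768 * 8 ^ A * H := mul_nonneg (by positivity) (by linarith)
    linarith
  · obtain ⟨s, hs1⟩ : ∃ s, s0 = s + 1 := ⟨_, h0⟩
    have b2 : ¬ n < 96 * 2 ^ (t s) := Nat.find_min hex (by omega)
    have b3 : 96 * (2:ℝ) ^ (t s) ≤ n := by
      push Not at b2
      exact_mod_cast b2
    rw [hs1] at hlt
    have hk : (0:ℝ) < 2 ^ (e0 + 3 * s) := by positivity
    have hL0 : (0:ℝ) < P.L s := by exact_mod_cast P.L_pos s
    have c1 := hs.L_le s
    have c2 := hs.L_ge s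
    have c3 := hs.Deq s
    have c4 := hs.lo s
    have hD0 : (0:ℝ) < 2 ^ P.D s := by positivity
    have cond : 96 * P.L s ^ 2 * 2 ^ P.D s ≤ n := by
      have : (96:ℝ) * P.L s ^ 2 * 2 ^ P.D s ≤ n := by
        refine le_trans ?_ b3
        rw [← c3]
        have : (P.L s : ℝ) ^ 2 ≤ (2 ^ (e0 + 3 * s)) ^ 2 := by gcongr
        nlinarith
      exact_mod_cast this
    have d1 := Par.entropy_lower (P := P) s n cond
    have d2 : f (2 ^ t s) / 2 ≤ (P.L s : ℝ) * 2 ^ P.D s := by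
      set k : ℝ := 2 ^ (e0 + 3 * s)
      have : k * f (2 ^ t s) ≤ k * (2 ^ P.D s * k) := by nlinarith
      have : f (2 ^ t s) ≤ 2 ^ P.D s * k := le_of_mul_le_mul_left this hk
      nlinarith
    have hm1 := one_le_twoPow (t s)
    have hfm := hf.one _ hm1
    have d3 : f (2 ^ t s) / 8 ≤ H := by
      refine le_trans ?_ d1
      nlinarith
    have d4 := hf.sub (2 ^ t s) n hm1 (by linarith)
    have d5 : (2:ℝ) ^ t (s + 1) ≤ 8 ^ A * 2 ^ t s := by
      calc (2:ℝ) ^ t (s + 1) ≤ 2 ^ (t s + 3 * A) := pow_le_pow_right₀ (by norm_num) (hs.le s)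
        _ = 8 ^ A * 2 ^ t s := by rw [pow_add, pow_mul]; norm_num; ring
    have d6 : (2 ^ t s) * f n ≤ (2 ^ t s) * (96 * 8 ^ A * f (2 ^ t s)) := by
      refine d4.trans ?_
      have : (n:ℝ) ≤ 96 * (8 ^ A * 2 ^ t s) := by linarith
      calc (n:ℝ) * f (2 ^ t s) ≤ 96 * (8 ^ A * 2 ^ t s) * f (2 ^ t s) := by gcongr
        _ = _ := by ring
    have d7 : f n ≤ 96 * 8 ^ A * f (2 ^ t s) := le_of_mul_le_mul_left d6 (by linarith)
    have d8 : 96 * 8 ^ A * f (2 ^ t s) ≤ 96 * 8 ^ A * (8 * H) := by gcongr; linarith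
    have : 0 ≤ 192 * 2 ^ (A * e0) * H := mul_nonneg (by positivity) (by linarith)
    linarith

end final

lemma gr_of (γ : ℝ) (hγ : γ ∈ Set.Ico (3 / 4 : ℝ) 1) (f : ℝ → ℝ)
    (hpos : ∀ x : ℝ, 1 ≤ x → 0 < f x) (h1 : f 1 = 1)
    (h : ∀ a n : ℝ, 1 ≤ a → 1 ≤ n →
          a ^ ((3 : ℝ) / 4) * f n ≤ f (a * n) ∧ f (a * n) ≤ a ^ γ * f n) : Gr f := by
  have mono : ∀ x y, 1 ≤ x → x ≤ y → f x ≤ f y := by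
    intro x y hx hxy
    have hx0 : 0 < x := by linarith
    have ha : 1 ≤ y / x := by rw [le_div_iff₀ hx0]; linarith
    have := (h (y / x) x ha hx).1
    rw [div_mul_cancel₀ _ hx0.ne'] at this
    have h2 : 1 ≤ (y / x) ^ ((3:ℝ)/4) := Real.one_le_rpow ha (by norm_num)
    nlinarith [hpos x hx]
  refine ⟨fun x hx => by have := mono 1 x le_rfl hx; rwa [h1] at this, mono, ?_⟩
  intro x y hx hxy
  have hx0 : 0 < x := by linarith
  have ha : 1 ≤ y / x := by rw [le_div_iff₀ hx0]; linarith
  have := (h (y / x) x ha hx).2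
  rw [div_mul_cancel₀ _ hx0.ne'] at this
  have h2 : (y / x) ^ γ ≤ y / x := by
    calc (y / x) ^ γ ≤ (y / x) ^ (1:ℝ) := Real.rpow_le_rpow_of_exponent_le ha hγ.2.le
      _ = _ := Real.rpow_one _
  have h3 : f y ≤ y / x * f x := this.trans (by have := hpos x hx; gcongr)
  calc x * f y ≤ x * (y / x * f x) := by gcongr
    _ = y * f x := by field_simp

lemma dy_of (γ : ℝ) (A : ℕ) (hA : 1 ≤ (1 - γ) * A) (f : ℝ → ℝ)
    (hpos : ∀ x : ℝ, 1 ≤ x → 0 < f x) (h1 : f 1 = 1)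
    (h : ∀ a n : ℝ, 1 ≤ a → 1 ≤ n →
          a ^ ((3 : ℝ) / 4) * f n ≤ f (a * n) ∧ f (a * n) ≤ a ^ γ * f n) :
    Dy (fun t => f (2 ^ t)) A := by
  have hfour : ∀ x : ℝ, 0 ≤ x → (x ^ ((3:ℝ)/4)) ^ 4 = x ^ 3 := by
    intro x hx
    rw [← Real.rpow_natCast, ← Real.rpow_mul hx, ← Real.rpow_natCast]
    norm_num
  refine ⟨by simp [h1], ?_, ?_, ?_⟩
  · intro t
    have h2 := (h 2 (2 ^ t) (by norm_num) (one_le_pow₀ (by norm_num))).1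
    have hp := hpos (2 ^ t) (one_le_pow₀ (by norm_num))
    have h3 : (3/2 : ℝ) ≤ 2 ^ ((3:ℝ)/4) := by
      have h4 := hfour 2 (by norm_num)
      have : (0:ℝ) ≤ 2 ^ ((3:ℝ)/4) := by positivity
      refine le_of_pow_le_pow_left₀ (n := 4) (by norm_num) this ?_
      rw [h4]; norm_num
    show 3 / 2 * f (2 ^ t) ≤ f (2 ^ (t + 1))
    rw [pow_succ, mul_comm _ (2:ℝ)]
    nlinarith
  · intro t
    have h2 := (h (2 ^ A) (2 ^ t) (one_le_pow₀ (by norm_num)) (one_le_pow₀ (by norm_num))).2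
    have hp := hpos (2 ^ t) (one_le_pow₀ (by norm_num))
    show 2 * f (2 ^ (t + A)) ≤ 2 ^ A * f (2 ^ t)
    rw [pow_add, mul_comm _ ((2:ℝ) ^ A)]
    have h3 : 2 * ((2:ℝ) ^ A) ^ γ ≤ 2 ^ A := by
      rw [← Real.rpow_natCast 2 A, ← Real.rpow_mul (by norm_num)]
      calc 2 * (2:ℝ) ^ ((A:ℝ) * γ) = 2 ^ (1 + (A:ℝ) * γ) := by
            rw [Real.rpow_add (by norm_num), Real.rpow_one]
        _ ≤ 2 ^ (A:ℝ) := Real.rpow_le_rpow_of_exponent_le (by norm_num) (by linarith)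
    nlinarith
  · intro t
    have h2 := (h (2 ^ t) 1 (one_le_pow₀ (by norm_num)) le_rfl).1
    rw [h1, mul_one, mul_one] at h2
    have h3 := hfour (2 ^ t) (by positivity)
    show (8:ℝ) ^ t ≤ f (2 ^ t) ^ 4
    calc (8:ℝ) ^ t = (2 ^ t) ^ 3 := by rw [← pow_mul, mul_comm, pow_mul]; norm_num
      _ = (((2:ℝ) ^ t) ^ ((3:ℝ)/4)) ^ 4 := h3.symm
      _ ≤ _ := by gcongr

lemma exists_e0 (A : ℕ) : ∃ e0 : ℕ, 1 ≤ e0 ∧ ∀ e, e0 ≤ e → 16 * (A * e) ≤ 2 ^ e := by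
  have h1 := tendsto_pow_const_div_const_pow_of_one_lt 1 (show (1:ℝ) < 2 by norm_num)
  have h2 : ∀ᶠ e : ℕ in Filter.atTop, (e:ℝ) ^ 1 / 2 ^ e < 1 / (16 * A + 1) :=
    h1.eventually_lt_const (by positivity)
  obtain ⟨N, hN⟩ := Filter.eventually_atTop.1 h2
  refine ⟨N + 1, by omega, fun e he => ?_⟩
  have h3 := hN e (by omega)
  rw [pow_one, div_lt_div_iff₀ (by positivity) (by positivity)] at h3
  have : (16 * (A * e) : ℝ) ≤ 2 ^ e := by
    have : (0:ℝ) ≤ e := by positivity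
    nlinarith
  exact_mod_cast this

/-- **Theorem 2, clause (2).** For any `γ ∈ [3/4, 1)` and any `f : [1,∞) → (0,∞)` with
`f(1) = 1` satisfying the log-Lipschitz condition `a^{3/4} f(n) ≤ f(an) ≤ a^γ f(n)` for all
real `a, n ≥ 1`, there is a finitely generated group with a finite symmetric generating set
and a symmetric finitely supported random walk `X_n` on it with
`E|X_n| ≍ H(X_n) ≍ f(n)`, with implied constants depending only on `γ`. -/
theorem speed_entropy_equal_prescribed
    (γ : ℝ) (hγ : γ ∈ Set.Ico (3 / 4 : ℝ) 1) :
    ∃ C : ℝ, 0 < C ∧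
      ∀ f : ℝ → ℝ,
        (∀ x : ℝ, 1 ≤ x → 0 < f x) → f 1 = 1 →
        (∀ a n : ℝ, 1 ≤ a → 1 ≤ n →
          a ^ ((3 : ℝ) / 4) * f n ≤ f (a * n) ∧ f (a * n) ≤ a ^ γ * f n) →
        ∃ (G : Type) (_ : Group G) (S : Set G) (μ : G → ℝ),
          IsGenSet S ∧ IsStepDist μ ∧
          ∀ n : ℕ, 1 ≤ n →
            (speed S μ n ≤ C * f n ∧ f n ≤ C * speed S μ n) ∧
            (entropy (convPow μ n) ≤ C * f n ∧ f n ≤ C * entropy (convPow μ n)) := by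
  obtain ⟨A, hA⟩ := exists_nat_ge (1 / (1 - γ))
  have hg : 0 < 1 - γ := by linarith [hγ.2]
  have hA1 : 1 ≤ (1 - γ) * A := by
    rw [div_le_iff₀ hg] at hA; linarith
  obtain ⟨e0, he0, hlin⟩ := exists_e0 A
  obtain ⟨C1, hC1⟩ : ∃ C1 : ℝ, C1 = 192 * 2 ^ (A * e0) + 768 * 8 ^ A := ⟨_, rfl⟩
  obtain ⟨C2, hC2⟩ : ∃ C2 : ℝ, C2 = 3 * 2 ^ e0 + 750 := ⟨_, rfl⟩
  have hC1p : 1 ≤ C1 := by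
    have : (1:ℝ) ≤ 8 ^ A := one_le_pow₀ (by norm_num)
    have : (0:ℝ) < 2 ^ (A * e0) := by positivity
    linarith
  have hC2p : 0 < C2 := by rw [hC2]; positivity
  set δ : ℝ := 1 / (4 * C1) with hδ
  have hδp : 0 < δ := by positivity
  have hδC : C1 * δ = 1 / 4 := by rw [hδ]; field_simp
  have hδ1 : δ ≤ 1 / 4 := by nlinarith
  set κ : ℝ := - Real.log (δ / 4) with hκ
  have hexp : 4 * Real.exp (-κ) = δ := by
    rw [hκ, neg_neg, Real.exp_log (by positivity)]; ring
  have hκp : 0 < κ := by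
    rw [hκ, neg_pos]; exact Real.log_neg (by positivity) (by linarith)
  have heps : (1 - δ)⁻¹ - 1 ≤ 2 * δ := by
    have h1 : (0:ℝ) < 1 - δ := by linarith
    rw [sub_le_iff_le_add, inv_le_iff_one_le_mul₀ h1]
    nlinarith
  refine ⟨C1 + C2 + 2 * C1 * κ + κ * C2 + 1, by positivity, ?_⟩
  intro f hpos h1 h
  have hf := gr_of γ hγ f hpos h1 h
  have hd := dy_of γ A hA1 f hpos h1 h
  obtain ⟨P, t, hs⟩ := hd.exists_sel e0 he0 hlin
  refine ⟨↥(Par.Gp P), inferInstance, Set.range (Par.gen P), stepLaw (Par.val P),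
    Par.isGenSet_gen, Par.isStepDist_val, ?_⟩
  intro n hn
  have hfn : 1 ≤ f n := hf.one n (by exact_mod_cast hn)
  have a1 := speed_final he0 hf hd hs n hn
  have a2 := entropy_final hf hs n hn h1
  have a3 := entropy_le_speed (Par.val P) (Par.gen P) Par.isGenSet_gen n κ (by rw [hexp]; linarith)
  rw [hexp] at a3
  rw [← hC1] at a2
  rw [← hC2] at a1
  set H := entropy (convPow (stepLaw (Par.val P)) n)
  set V := speed (Set.range (Par.gen P)) (stepLaw (Par.val P)) n
  have hH : 0 < H := by
    by_contra hc
    push Not at hc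
    nlinarith
  have hfV : f n ≤ 2 * C1 * κ * V := by
    have b1 : C1 * H ≤ C1 * (κ * V + 2 * δ) := by
      apply mul_le_mul_of_nonneg_left _ (by linarith); linarith
    nlinarith
  have hV : 0 < V := by
    by_contra hc
    push Not at hc
    have : 2 * C1 * κ * V ≤ 0 := mul_nonpos_of_nonneg_of_nonpos (by positivity) hc
    linarith
  have hc1 : 0 ≤ C1 * κ := by positivity
  have hc2 : 0 ≤ κ * C2 := by positivity
  refine ⟨⟨?_, ?_⟩, ?_, ?_⟩
  · refine a1.trans ?_
    gcongr
    linarith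
  · refine hfV.trans ?_
    gcongr
    linarith
  · have b1 : κ * V ≤ κ * (C2 * f n) := by gcongr
    have b2 : H ≤ (κ * C2 + 1) * f n := by nlinarith
    refine b2.trans ?_
    gcongr
    linarith
  · refine a2.trans ?_
    gcongr
    linarith
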